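/- arXiv:2206.14773 — 2 statements merged into one kernel-verified Lean document; each statement's English description precedes it below -/
import Mathlib

section
/- Let n ≥ 2. Parametrize the group N_n of upper triangular n×n real matrices with ones on the diagonal by the entries x = (x_{ij})_{1 ≤ i < j ≤ n} ∈ ℝ^{n(n-1)/2}, writing u(x) for the corresponding matrix. For 1 ≤ k ≤ n-1 let G_k(x) denote the k-th trailing Gram determinant of u(x). Then for every ε > 0, the integral ∫_{ℝ^{n(n-1)/2}} (∏_{k=1}^{n-1} G_k(x))^{-1/2} · (1 + (1/2) Σ_{k=1}^{n-1} log G_k(x))^{-n(n-1)/2 - ε} dx is finite. -/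
open MeasureTheory

/-- The `k`-th trailing Gram determinant of an `n × n` real matrix `M` (for `k ≤ n`):
the determinant of the `k × k` matrix whose `(p,q)` entry is the Euclidean inner
product of columns `n - k + p` and `n - k + q` of `M`. -/
noncomputable def trailingGram (n k : ℕ) (hk : k ≤ n) (M : Matrix (Fin n) (Fin n) ℝ) : ℝ :=
  Matrix.det (Matrix.of fun p q : Fin k =>
    ∑ i : Fin n,
      M i ⟨n - k + (p : ℕ), by have := p.isLt; omega⟩ *
      M i ⟨n - k + (q : ℕ), by have := q.isLt; omega⟩)

/-- The upper triangular unipotent matrix with above-diagonal entries given by `x`. -/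
def upperUnipotent (n : ℕ) (x : {p : Fin n × Fin n // p.1 < p.2} → ℝ) :
    Matrix (Fin n) (Fin n) ℝ :=
  Matrix.of fun i j => if h : i < j then x ⟨(i, j), h⟩ else if i = j then 1 else 0


lemma hc_det_rank_one {k : ℕ} (V : Matrix (Fin k) (Fin k) ℝ) (hV : V.PosDef) (r : Fin k → ℝ) :
    (V + Matrix.vecMulVec r r).det = V.det + ∑ p, ∑ q, r p * V.adjugate p q * r q := by
  have hd : IsUnit V.det := isUnit_iff_ne_zero.mpr hV.det_pos.ne'
  have h := Matrix.det_add_replicateCol_mul_replicateRow (ι := Unit) hd r r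
  have e : Matrix.replicateCol Unit r * Matrix.replicateRow Unit r = Matrix.vecMulVec r r := by
    ext p q; simp [Matrix.mul_apply, Matrix.vecMulVec_apply]
  rw [e] at h
  rw [h, Matrix.det_unique (n := Unit)]
  have : V.det ≠ 0 := hV.det_pos.ne'
  simp only [Matrix.add_apply, Matrix.mul_apply, Matrix.inv_def, Matrix.smul_apply,
    Matrix.replicateRow_apply, Matrix.replicateCol_apply, Matrix.one_apply_eq, mul_one,
    mul_add, smul_eq_mul, Ring.inverse_eq_inv', Finset.sum_mul, Finset.mul_sum]
  congr 1
  rw [Finset.sum_comm]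
  refine Finset.sum_congr rfl fun p _ => Finset.sum_congr rfl fun q _ => ?_
  field_simp

lemma hc_det_rank_one_ge {k : ℕ} (V : Matrix (Fin k) (Fin k) ℝ) (hV : V.PosDef) (r : Fin k → ℝ) :
    V.det ≤ (V + Matrix.vecMulVec r r).det := by
  rw [hc_det_rank_one V hV]
  have h0 := hV.inv.posSemidef.dotProduct_mulVec_nonneg r
  have : V.det ≠ 0 := hV.det_pos.ne'
  have : ∑ p, ∑ q, r p * V.adjugate p q * r q = V.det * (star r ⬝ᵥ (V⁻¹.mulVec r)) := by
    simp only [dotProduct, Matrix.mulVec, Matrix.inv_def, Matrix.smul_apply, smul_eq_mul,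
      Ring.inverse_eq_inv', Finset.mul_sum, star_trivial]
    refine Finset.sum_congr rfl fun p _ => Finset.sum_congr rfl fun q _ => ?_
    field_simp
  rw [this]
  have := mul_nonneg hV.det_pos.le h0
  linarith

/-- in its first coordinate, the rank one update is a quadratic polynomial. -/
lemma hc_det_quadratic {k : ℕ} (V : Matrix (Fin (k+1)) (Fin (k+1)) ℝ) (hV : V.PosDef)
    (r : Fin k → ℝ) : ∃ b c : ℝ, ∀ y : ℝ,
    (V + Matrix.vecMulVec (Fin.cons y r) (Fin.cons y r)).det
      = (V.submatrix Fin.succ Fin.succ).det * y ^ 2 + b * y + c := by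
  refine ⟨∑ q, V.adjugate 0 q.succ * r q + ∑ p, r p * V.adjugate p.succ 0,
    V.det + ∑ p, ∑ q, r p * V.adjugate p.succ q.succ * r q, fun y => ?_⟩
  rw [hc_det_rank_one V hV]
  have h0 : V.adjugate 0 0 = (V.submatrix Fin.succ Fin.succ).det := by
    rw [Matrix.adjugate_fin_succ_eq_det_submatrix]; simp
  simp only [Fin.sum_univ_succ, Fin.cons_zero, Fin.cons_succ, h0, Finset.sum_add_distrib]
  rw [add_mul, Finset.sum_mul, Finset.sum_mul]
  have e1 : ∑ q, y * V.adjugate 0 (Fin.succ q) * r q = ∑ q, V.adjugate 0 (Fin.succ q) * r q * y :=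
    Finset.sum_congr rfl fun _ _ => by ring
  rw [e1]
  ring

abbrev hcIdx (n : ℕ) := {p : Fin n × Fin n // p.1 < p.2}

/-- entries of the unipotent matrix, indexed by naturals -/
def hcW (n : ℕ) (x : hcIdx n → ℝ) (i j : ℕ) : ℝ :=
  if h : i < j ∧ j < n then x ⟨(⟨i, h.1.trans h.2⟩, ⟨j, h.2⟩), h.1⟩ else if i = j then 1 else 0

def hcM (n : ℕ) (i k : ℕ) (x : hcIdx n → ℝ) : Matrix (Fin k) (Fin k) ℝ :=
  Matrix.of fun p q => ∑ l ∈ Finset.Ico i n, hcW n x l (n - k + p) * hcW n x l (n - k + q)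

noncomputable def hcD (n : ℕ) (i k : ℕ) (x : hcIdx n → ℝ) : ℝ := (hcM n i k x).det

lemma hcD_eq (n k : ℕ) (hk : k ≤ n) (x : hcIdx n → ℝ) :
    trailingGram n k hk (upperUnipotent n x) = hcD n 0 k x := by
  unfold trailingGram hcD hcM
  congr 1
  ext p q
  simp only [Matrix.of_apply]
  rw [Nat.Ico_zero_eq_range, Finset.sum_range]
  refine Finset.sum_congr rfl fun i _ => ?_
  have key : ∀ (p : Fin k) (h : n - k + (p:ℕ) < n),
      upperUnipotent n x i ⟨n - k + p, h⟩ = hcW n x i (n - k + p) := by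
    intro p h
    simp only [upperUnipotent, hcW, Matrix.of_apply, Fin.lt_def, Fin.ext_iff]
    by_cases h1 : (i:ℕ) < n - k + p
    · simp [h1, h]
    · simp [h1]
  rw [key, key]

lemma hcM_rec (n i k : ℕ) (hi : i < n) (x : hcIdx n → ℝ) :
    hcM n i k x = hcM n (i+1) k x +
      Matrix.vecMulVec (fun p : Fin k => hcW n x i (n - k + p)) (fun p : Fin k => hcW n x i (n - k + p)) := by
  ext p q
  simp only [hcM, Matrix.of_apply, Matrix.add_apply, Matrix.vecMulVec_apply]
  rw [Finset.sum_eq_sum_Ico_succ_bot hi, add_comm]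

lemma hcM_base (n k : ℕ) (hk : k ≤ n) (x : hcIdx n → ℝ) :
    hcM n (n - k) k x = 
      Matrix.transpose (Matrix.of fun l p : Fin k => hcW n x (n - k + l) (n - k + p)) *
      (Matrix.of fun l p : Fin k => hcW n x (n - k + l) (n - k + p)) := by
  ext p q
  simp only [hcM, Matrix.of_apply, Matrix.mul_apply, Matrix.transpose_apply]
  rw [Finset.sum_Ico_eq_sum_range, Nat.sub_sub_self hk, Finset.sum_range]

lemma hcD_base (n k : ℕ) (hk : k ≤ n) (x : hcIdx n → ℝ) : hcD n (n - k) k x = 1 := by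
  have : (Matrix.of fun l p : Fin k => hcW n x (n - k + l) (n - k + p)).det = 1 := by
    rw [Matrix.det_of_isUpperTriangular]
    · simp [hcW]
    · intro l p h
      simp only [id] at h
      have h' : (p:ℕ) < l := h
      simp only [Matrix.of_apply, hcW]
      rw [dif_neg (by omega), if_neg (by omega)]
  rw [hcD, hcM_base n k hk, Matrix.det_mul, Matrix.det_transpose, this, one_mul]

lemma hcM_posDef (n k : ℕ) (hk : k ≤ n) (x : hcIdx n → ℝ) (m : ℕ) (hm : m ≤ n - k) :
    (hcM n (n - k - m) k x).PosDef ∧ 1 ≤ hcD n (n - k - m) k x := by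
  induction m with
  | zero =>
    have h1 := hcD_base n k hk x
    refine ⟨?_, by simp [h1]⟩
    rw [Nat.sub_zero]
    refine (Matrix.PosSemidef.posDef_iff_det_ne_zero ?_).mpr ?_
    · rw [hcM_base n k hk x]
      exact Matrix.posSemidef_conjTranspose_mul_self _
    · change hcD n (n - k) k x ≠ 0
      rw [h1]; exact one_ne_zero
  | succ m ih =>
    obtain ⟨ih1, ih2⟩ := ih (by omega)
    have e : n - k - (m+1) + 1 = n - k - m := by omega
    rw [hcD, hcM_rec n (n - k - (m+1)) k (by omega) x, e]
    refine ⟨ih1.add_posSemidef ?_, ih2.trans (hc_det_rank_one_ge _ ih1 _)⟩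
    simpa using Matrix.posSemidef_vecMulVec_self_star (R := ℝ) _

lemma hcM_posDef' (n i k : ℕ) (h : i + k ≤ n) (x : hcIdx n → ℝ) : (hcM n i k x).PosDef := by
  have := (hcM_posDef n k (by omega) x (n - k - i) (by omega)).1
  rwa [show n - k - (n - k - i) = i by omega] at this

lemma hcD_ge_one (n i k : ℕ) (h : i + k ≤ n) (x : hcIdx n → ℝ) : 1 ≤ hcD n i k x := by
  have := (hcM_posDef n k (by omega) x (n - k - i) (by omega)).2
  rwa [show n - k - (n - k - i) = i by omega] at this

lemma hcD_zero (n i : ℕ) (x : hcIdx n → ℝ) : hcD n i 0 x = 1 := by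
  simp [hcD]

lemma hcW_update (n : ℕ) (x : hcIdx n → ℝ) (e : hcIdx n) (y : ℝ) (i j : ℕ)
    (h : i ≠ e.1.1 ∨ j ≠ e.1.2) : hcW n (Function.update x e y) i j = hcW n x i j := by
  unfold hcW
  split_ifs with h1 h2
  · rw [Function.update_of_ne]
    rintro rfl
    simp at h
  all_goals rfl

lemma hcW_update_self (n : ℕ) (x : hcIdx n → ℝ) (e : hcIdx n) (y : ℝ) :
    hcW n (Function.update x e y) e.1.1 e.1.2 = y := by
  have h : ((e.1.1 : ℕ) < e.1.2 ∧ (e.1.2 : ℕ) < n) := ⟨e.2, e.1.2.2⟩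
  unfold hcW
  rw [dif_pos h]
  simp

lemma hcD_update (n : ℕ) (x : hcIdx n → ℝ) (e : hcIdx n) (y : ℝ) (i k : ℕ)
    (h : (e.1.1 : ℕ) < i ∨ (e.1.2 : ℕ) < n - k) :
    hcD n i k (Function.update x e y) = hcD n i k x := by
  unfold hcD hcM
  congr 1
  ext p q
  simp only [Matrix.of_apply]
  refine Finset.sum_congr rfl fun l hl => ?_
  have := (Finset.mem_Ico.mp hl).1
  rw [hcW_update _ _ _ _ _ _ (by omega), hcW_update _ _ _ _ _ _ (by omega)]

lemma hcD_quadratic (n : ℕ) (x : hcIdx n → ℝ) (e : hcIdx n) (k : ℕ)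
    (he : (e.1.2 : ℕ) + k + 1 = n) :
    (∃ b c : ℝ, ∀ y : ℝ, hcD n e.1.1 (k+1) (Function.update x e y)
      = hcD n (e.1.1 + 1) k x * y ^ 2 + b * y + c) ∧
    ∀ y : ℝ, hcD n (e.1.1 + 1) (k+1) x ≤ hcD n e.1.1 (k+1) (Function.update x e y) := by
  have hlt : (e.1.1 : ℕ) < e.1.2 := e.2
  have hP := hcM_posDef' n (e.1.1 + 1) (k+1) (by omega) x
  have hU : ∀ y, hcM n e.1.1 (k+1) (Function.update x e y) = hcM n (e.1.1+1) (k+1) x +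
      Matrix.vecMulVec (Fin.cons y fun p : Fin k => hcW n x e.1.1 (n - k + p))
        (Fin.cons y fun p : Fin k => hcW n x e.1.1 (n - k + p)) := by
    intro y
    rw [hcM_rec _ _ _ e.1.1.2]
    have h1 : hcM n (e.1.1+1) (k+1) (Function.update x e y) = hcM n (e.1.1+1) (k+1) x := by
      unfold hcM
      ext p q
      simp only [Matrix.of_apply]
      refine Finset.sum_congr rfl fun l hl => ?_
      have := (Finset.mem_Ico.mp hl).1
      rw [hcW_update _ _ _ _ _ _ (by omega), hcW_update _ _ _ _ _ _ (by omega)]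
    have h2 : (fun p : Fin (k+1) => hcW n (Function.update x e y) e.1.1 (n - (k+1) + p)) =
        Fin.cons y fun p : Fin k => hcW n x e.1.1 (n - k + p) := by
      funext p
      refine Fin.cases ?_ (fun p => ?_) p
      · rw [show n - (k+1) + ((0 : Fin (k+1)) : ℕ) = e.1.2 by simp; omega]
        simp [hcW_update_self]
      · rw [show n - (k+1) + (p.succ : ℕ) = n - k + p by simp; omega, Fin.cons_succ,
          hcW_update _ _ _ _ _ _ (by omega)]
    rw [h1, h2]
  have hS : (hcM n (e.1.1+1) (k+1) x).submatrix Fin.succ Fin.succ = hcM n (e.1.1+1) k x := by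
    ext p q
    simp only [hcM, Matrix.submatrix_apply, Matrix.of_apply]
    rw [show n - (k+1) + (p.succ : ℕ) = n - k + p by simp; omega,
      show n - (k+1) + (q.succ : ℕ) = n - k + q by simp; omega]
  constructor
  · obtain ⟨b, c, h⟩ := hc_det_quadratic _ hP (fun p : Fin k => hcW n x e.1.1 (n - k + p))
    refine ⟨b, c, fun y => ?_⟩
    rw [hcD, hU, h, hS, hcD]
  · intro y
    rw [hcD, hcD, hU]
    exact hc_det_rank_one_ge _ hP _

lemma hcD_continuous (n i k : ℕ) : Continuous (hcD n i k) := by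
  unfold hcD hcM
  refine Continuous.matrix_det ?_
  refine continuous_matrix fun p q => ?_
  simp only [Matrix.of_apply]
  have : ∀ a b, Continuous fun x => hcW n x a b := by
    intro a b
    unfold hcW
    split_ifs <;> fun_prop
  fun_prop

open scoped ENNReal in
lemma hc_c_bound (t : ℝ) (ht : 0 < t) (ht1 : t ≤ 1) :
    ∫⁻ z : ℝ, ENNReal.ofReal ((1 + z ^ 2) ^ (-(1 + t) / 2)) ≤ ENNReal.ofReal (4 / t) := by
  have hIoi : ∫⁻ z in Set.Ioi (0:ℝ), ENNReal.ofReal ((1 + z ^ 2) ^ (-(1 + t) / 2))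
      ≤ ENNReal.ofReal (2 / t) := by
    rw [← Set.Ioc_union_Ioi_eq_Ioi (zero_le_one (α := ℝ))]
    refine (lintegral_union_le _ _ _).trans ?_
    have h1 : ∫⁻ z in Set.Ioc (0:ℝ) 1, ENNReal.ofReal ((1 + z ^ 2) ^ (-(1 + t) / 2)) ≤
        ENNReal.ofReal 1 := by
      calc _ ≤ ∫⁻ z in Set.Ioc (0:ℝ) 1, 1 := by
            refine lintegral_mono fun z => ?_
            rw [← ENNReal.ofReal_one]
            apply ENNReal.ofReal_le_ofReal
            apply Real.rpow_le_one_of_one_le_of_nonpos <;> nlinarith [sq_nonneg z]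
        _ = _ := by simp
    have h2 : ∫⁻ z in Set.Ioi (1:ℝ), ENNReal.ofReal ((1 + z ^ 2) ^ (-(1 + t) / 2)) ≤
        ENNReal.ofReal (1 / t) := by
      calc _ ≤ ∫⁻ z in Set.Ioi (1:ℝ), ENNReal.ofReal (z ^ (-(1 + t))) := by
            refine setLIntegral_mono' measurableSet_Ioi fun z hz => ?_
            have hz : (1:ℝ) < z := hz
            apply ENNReal.ofReal_le_ofReal
            have : z ^ (-(1 + t)) = (z ^ 2) ^ (-(1 + t) / 2) := by
              rw [← Real.rpow_natCast, ← Real.rpow_mul (by linarith)]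
              congr 1; push_cast; ring
            rw [this]
            apply Real.rpow_le_rpow_of_nonpos <;> nlinarith
        _ = ENNReal.ofReal (∫ z in Set.Ioi (1:ℝ), z ^ (-(1 + t))) := by
            rw [ofReal_integral_eq_lintegral_ofReal]
            · exact integrableOn_Ioi_rpow_of_lt (by linarith) one_pos
            · refine (ae_restrict_iff' measurableSet_Ioi).mpr (Filter.Eventually.of_forall ?_)
              intro z hz
              have hz : (1:ℝ) < z := hz
              exact Real.rpow_nonneg (by linarith) _
        _ = _ := by
            rw [integral_Ioi_rpow_of_lt (by linarith) one_pos]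
            congr 1
            rw [Real.one_rpow, show -(1+t)+1 = -t by ring, neg_div_neg_eq]
    refine (add_le_add h1 h2).trans ?_
    rw [← ENNReal.ofReal_add zero_le_one (by positivity)]
    apply ENNReal.ofReal_le_ofReal
    have : 1 ≤ 1 / t := by rw [le_div_iff₀ ht]; linarith
    have : 2 / t = 1/t + 1/t := by ring
    linarith
  have hIio : ∫⁻ z in Set.Iio (0:ℝ), ENNReal.ofReal ((1 + z ^ 2) ^ (-(1 + t) / 2))
      = ∫⁻ z in Set.Ioi (0:ℝ), ENNReal.ofReal ((1 + z ^ 2) ^ (-(1 + t) / 2)) := by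
    rw [← lintegral_indicator measurableSet_Iio, ← lintegral_indicator measurableSet_Ioi,
      ← lintegral_neg_eq_self]
    congr 1
    funext z
    simp [Set.indicator]
  have hs : ∫⁻ z : ℝ, ENNReal.ofReal ((1 + z ^ 2) ^ (-(1 + t) / 2)) =
      ∫⁻ z in Set.Iio (0:ℝ) ∪ Set.Ioi 0, ENNReal.ofReal ((1 + z ^ 2) ^ (-(1 + t) / 2)) := by
    rw [Set.Iio_union_Ioi, restrict_compl_singleton]
  rw [hs]
  refine (lintegral_union_le _ _ _).trans ?_
  rw [hIio]
  refine (add_le_add hIoi hIoi).trans ?_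
  rw [← ENNReal.ofReal_add (by positivity) (by positivity)]
  apply ENNReal.ofReal_le_ofReal
  apply le_of_eq; ring

lemma hc_quad_int (t a b c m : ℝ) (ht : 0 < t) (ht1 : t ≤ 1) (ha : 0 < a) (hm : 0 < m)
    (hq : ∀ y : ℝ, m ≤ a * y ^ 2 + b * y + c) :
    ∫⁻ y : ℝ, ENNReal.ofReal ((a * y ^ 2 + b * y + c) ^ (-(1 + t) / 2)) ≤
      ENNReal.ofReal (4 / t) * ENNReal.ofReal (a ^ (-(1:ℝ) / 2) * m ^ (-t / 2)) := by
  set h := b / (2 * a) with hh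
  set s := Real.sqrt (a / m) with hs
  have hspos : 0 < s := Real.sqrt_pos.mpr (by positivity)
  have hs2 : s ^ 2 = a / m := Real.sq_sqrt (by positivity)
  have hlow : ∀ y, m * (1 + (s * (y + h)) ^ 2) ≤ a * y ^ 2 + b * y + c := by
    intro y
    have h1 := hq (-h)
    have e1 : m * (1 + (s * (y + h)) ^ 2) = m + a * (y + h) ^ 2 := by
      rw [mul_pow, hs2]; field_simp
    have hb : b = 2 * a * h := by rw [hh]; field_simp
    rw [e1]
    rw [hb] at h1 ⊢
    nlinarith
  have hmeas : Measurable fun z : ℝ => ENNReal.ofReal ((1 + z ^ 2) ^ (-(1 + t) / 2)) := by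
    fun_prop
  calc _ ≤ ∫⁻ y : ℝ, ENNReal.ofReal (m ^ (-(1 + t) / 2)) *
        ENNReal.ofReal ((1 + (s * (y + h)) ^ 2) ^ (-(1 + t) / 2)) := by
        refine lintegral_mono fun y => ?_
        rw [← ENNReal.ofReal_mul (by positivity), ← Real.mul_rpow hm.le (by positivity)]
        apply ENNReal.ofReal_le_ofReal
        exact Real.rpow_le_rpow_of_nonpos (by positivity) (hlow y) (by linarith)
    _ = ENNReal.ofReal (m ^ (-(1 + t) / 2)) *
        ∫⁻ y : ℝ, ENNReal.ofReal ((1 + (s * y) ^ 2) ^ (-(1 + t) / 2)) := by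
        rw [lintegral_const_mul _ (by fun_prop)]
        rw [lintegral_add_right_eq_self
          (fun y : ℝ => ENNReal.ofReal ((1 + (s * y) ^ 2) ^ (-(1 + t) / 2))) h]
    _ = ENNReal.ofReal (m ^ (-(1 + t) / 2)) *
        (ENNReal.ofReal s⁻¹ * ∫⁻ z : ℝ, ENNReal.ofReal ((1 + z ^ 2) ^ (-(1 + t) / 2))) := by
        congr 1
        have := lintegral_map (μ := volume) hmeas (measurable_const_mul s)
        rw [← this, Real.map_volume_mul_left hspos.ne', lintegral_smul_measure,
          abs_of_pos (inv_pos.mpr hspos), smul_eq_mul]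
    _ ≤ ENNReal.ofReal (m ^ (-(1 + t) / 2)) * (ENNReal.ofReal s⁻¹ * ENNReal.ofReal (4 / t)) := by
        gcongr
        exact hc_c_bound t ht ht1
    _ = _ := by
        rw [← ENNReal.ofReal_mul (by positivity), ← ENNReal.ofReal_mul (by positivity),
          ← ENNReal.ofReal_mul (by positivity)]
        congr 1
        have e : s⁻¹ = a ^ (-(1:ℝ)/2) * m ^ ((1:ℝ)/2) := by
          rw [hs, Real.sqrt_eq_rpow, ← Real.rpow_neg (by positivity),
            Real.div_rpow ha.le hm.le, neg_div, Real.rpow_neg hm.le]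
          field_simp
        have e2 : m ^ (-t / 2) = m ^ (-(1 + t) / 2) * m ^ ((1:ℝ)/2) := by
          rw [← Real.rpow_add hm]; congr 1; ring
        rw [e, e2]; ring

/-- elementary substitute for the Gamma integral -/
lemma hc_gamma (a L : ℝ) (ha : 0 < a) (hL : 0 ≤ L) :
    ENNReal.ofReal ((1 + L) ^ (-a)) ≤ ENNReal.ofReal (a * Real.exp 1) *
      ∫⁻ s in Set.Ioc (0:ℝ) 1, ENNReal.ofReal (s ^ (a - 1) * Real.exp (-(s * L))) := by
  have h1L : 0 < 1 + L := by linarith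
  set T := (1 + L)⁻¹ with hT
  have hT0 : 0 < T := inv_pos.mpr h1L
  have hT1 : T ≤ 1 := inv_le_one_of_one_le₀ (by linarith)
  have hint : IntervalIntegrable (fun s : ℝ => s ^ (a - 1)) volume 0 T :=
    intervalIntegral.intervalIntegrable_rpow' (by linarith)
  have hval : ∫⁻ s in Set.Ioc (0:ℝ) T, ENNReal.ofReal (s ^ (a - 1)) =
      ENNReal.ofReal (T ^ a / a) := by
    rw [← ofReal_integral_eq_lintegral_ofReal]
    · rw [← intervalIntegral.integral_of_le hT0.le, integral_rpow (Or.inl (by linarith))]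
      simp [Real.zero_rpow ha.ne']
    · exact (intervalIntegrable_iff_integrableOn_Ioc_of_le hT0.le).mp hint
    · refine (ae_restrict_iff' measurableSet_Ioc).mpr (Filter.Eventually.of_forall ?_)
      intro z hz
      exact Real.rpow_nonneg hz.1.le _
  calc ENNReal.ofReal ((1 + L) ^ (-a)) = ENNReal.ofReal (a * Real.exp 1) *
        (ENNReal.ofReal (Real.exp (-1)) * ENNReal.ofReal (T ^ a / a)) := by
        rw [← ENNReal.ofReal_mul (by positivity), ← ENNReal.ofReal_mul (by positivity)]
        congr 1
        rw [hT, Real.inv_rpow h1L.le, Real.rpow_neg h1L.le, Real.exp_neg]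
        field_simp
    _ = ENNReal.ofReal (a * Real.exp 1) * ∫⁻ s in Set.Ioc (0:ℝ) T,
        ENNReal.ofReal (Real.exp (-1)) * ENNReal.ofReal (s ^ (a - 1)) := by
        rw [lintegral_const_mul _ (by fun_prop), hval]
    _ ≤ ENNReal.ofReal (a * Real.exp 1) * ∫⁻ s in Set.Ioc (0:ℝ) T,
        ENNReal.ofReal (s ^ (a - 1) * Real.exp (-(s * L))) := by
        refine mul_le_mul_right ?_ _
        refine setLIntegral_mono' measurableSet_Ioc fun s hs => ?_
        rw [← ENNReal.ofReal_mul (by positivity), mul_comm]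
        apply ENNReal.ofReal_le_ofReal
        have := Real.rpow_nonneg hs.1.le (a - 1)
        gcongr
        have h3 : s * (1 + L) ≤ 1 := by
          calc s * (1 + L) ≤ T * (1 + L) := by gcongr; exact hs.2
            _ = 1 := inv_mul_cancel₀ h1L.ne'
        nlinarith [hs.1]
    _ ≤ _ := by
        refine mul_le_mul_right ?_ _
        exact lintegral_mono_set (Set.Ioc_subset_Ioc_right hT1)

lemma hc_eps_int (C ε : ℝ) (hε : 0 < ε) :
    ∫⁻ s in Set.Ioc (0:ℝ) 1, ENNReal.ofReal (C * s ^ (ε - 1)) < ⊤ := by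
  have hint : IntervalIntegrable (fun s : ℝ => s ^ (ε - 1)) volume 0 1 :=
    intervalIntegral.intervalIntegrable_rpow' (by linarith)
  have := ((intervalIntegrable_iff_integrableOn_Ioc_of_le zero_le_one).mp hint).const_mul C
  exact this.lintegral_lt_top

/-- the integrand after integrating the rows above `i` and all but the last `J` columns of row `i` -/
noncomputable def hcPhi (n : ℕ) (t : ℝ) (i J : ℕ) (x : hcIdx n → ℝ) : ℝ :=
  (∏ m ∈ Finset.range J, hcD n i (m + 1) x ^ (-(1 + t) / 2)) *
    ∏ m ∈ Finset.Ico J (n - 1 - i),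
      (hcD n (i + 1) m x ^ (-(1:ℝ) / 2) * hcD n (i + 1) (m + 1) x ^ (-t / 2))

def hcS (n i J : ℕ) : Finset (hcIdx n) :=
  Finset.univ.filter fun e => (e.1.1 : ℕ) < i ∨ ((e.1.1 : ℕ) = i ∧ (e.1.2 : ℕ) + J < n)

lemma hcPhi_step (n : ℕ) (t : ℝ) (ht : 0 < t) (ht1 : t ≤ 1) (i J : ℕ) (e : hcIdx n) (hi : (e.1.1 : ℕ) = i)
    (he : (e.1.2 : ℕ) + J + 1 = n) (x : hcIdx n → ℝ) :
    ∫⁻ y : ℝ, ENNReal.ofReal (hcPhi n t i (J + 1) (Function.update x e y)) ≤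
      ENNReal.ofReal (4 / t) * ENNReal.ofReal (hcPhi n t i J x) := by
  have hlt : (e.1.1 : ℕ) < e.1.2 := e.2
  set A : ℝ := ∏ m ∈ Finset.range J, hcD n i (m + 1) x ^ (-(1 + t) / 2) with hA
  set B : ℝ := ∏ m ∈ Finset.Ico (J+1) (n - 1 - i),
      (hcD n (i + 1) m x ^ (-(1:ℝ) / 2) * hcD n (i + 1) (m + 1) x ^ (-t / 2)) with hB
  have hA0 : 0 ≤ A := by
    refine Finset.prod_nonneg fun m hm => Real.rpow_nonneg ?_ _
    have := Finset.mem_range.mp hm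
    exact zero_le_one.trans (hcD_ge_one n i (m+1) (by omega) x)
  have hB0 : 0 ≤ B := by
    refine Finset.prod_nonneg fun m hm => ?_
    have := Finset.mem_Ico.mp hm
    refine mul_nonneg (Real.rpow_nonneg ?_ _) (Real.rpow_nonneg ?_ _)
    · exact zero_le_one.trans (hcD_ge_one n (i+1) m (by omega) x)
    · exact zero_le_one.trans (hcD_ge_one n (i+1) (m+1) (by omega) x)
  have e1 : ∀ y, hcPhi n t i (J + 1) (Function.update x e y) =
      (A * B) * hcD n i (J+1) (Function.update x e y) ^ (-(1 + t) / 2) := by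
    intro y
    unfold hcPhi
    rw [Finset.prod_range_succ]
    have h1 : ∏ m ∈ Finset.range J, hcD n i (m + 1) (Function.update x e y) ^ (-(1 + t) / 2)
        = A := by
      refine Finset.prod_congr rfl fun m hm => ?_
      have := Finset.mem_range.mp hm
      rw [hcD_update _ _ _ _ _ _ (by omega)]
    have h2 : ∏ m ∈ Finset.Ico (J+1) (n - 1 - i),
      (hcD n (i + 1) m (Function.update x e y) ^ (-(1:ℝ) / 2) *
        hcD n (i + 1) (m + 1) (Function.update x e y) ^ (-t / 2)) = B := by
      refine Finset.prod_congr rfl fun m hm => ?_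
      rw [hcD_update _ _ _ _ _ _ (by omega), hcD_update _ _ _ _ _ _ (by omega)]
    rw [h1, h2]; ring
  have e2 : hcPhi n t i J x = (A * B) * (hcD n (i + 1) J x ^ (-(1:ℝ) / 2) *
      hcD n (i + 1) (J + 1) x ^ (-t / 2)) := by
    unfold hcPhi
    rw [Finset.prod_eq_prod_Ico_succ_bot (show J < n - 1 - i by omega), ← hA, ← hB]; ring
  obtain ⟨⟨b, c, hq⟩, hge⟩ := hcD_quadratic n x e J he
  simp only [hi] at hq hge
  simp_rw [e1, hq, ENNReal.ofReal_mul (mul_nonneg hA0 hB0)]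
  rw [lintegral_const_mul _ (by fun_prop), e2, ENNReal.ofReal_mul (mul_nonneg hA0 hB0),
    mul_left_comm]
  refine mul_le_mul_right ?_ _
  refine hc_quad_int t _ b c _ ht ht1 ?_ ?_ ?_
  · exact zero_lt_one.trans_le (hcD_ge_one n (i+1) J (by omega) x)
  · exact zero_lt_one.trans_le (hcD_ge_one n (i+1) (J+1) (by omega) x)
  · intro y
    rw [← hq]; exact hge y

lemma hcPhi_measurable (n : ℕ) (t : ℝ) (i J : ℕ) :
    Measurable fun x => ENNReal.ofReal (hcPhi n t i J x) := by
  unfold hcPhi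
  have := fun i k => (hcD_continuous n i k).measurable
  fun_prop

lemma hcPhi_next (n : ℕ) (t : ℝ) (i : ℕ) (hi : i + 1 < n) (x : hcIdx n → ℝ) :
    hcPhi n t i 0 x = hcPhi n t (i+1) (n - 1 - (i+1)) x := by
  unfold hcPhi
  obtain ⟨N, hN⟩ : ∃ N, n - 1 - i = N + 1 := ⟨n - 2 - i, by omega⟩
  have hN' : n - 1 - (i + 1) = N := by omega
  rw [hN, hN', Finset.Ico_self, Finset.prod_empty, mul_one, Finset.range_zero, Finset.prod_empty,
    one_mul, Nat.Ico_zero_eq_range, Finset.prod_mul_distrib, Finset.prod_range_succ',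
    Finset.prod_range_succ (fun m => hcD n (i + 1) (m + 1) x ^ (-t / 2)), hcD_zero]
  have := hcD_base n (N+1) (by omega) x
  rw [show n - (N+1) = i + 1 by omega] at this
  rw [this, Real.one_rpow, Real.one_rpow, mul_one, mul_one, ← Finset.prod_mul_distrib]
  refine Finset.prod_congr rfl fun m hm => ?_
  have := Finset.mem_range.mp hm
  rw [← Real.rpow_add (zero_lt_one.trans_le (hcD_ge_one n (i+1) (m+1) (by omega) x))]
  congr 1; ring

def hcGoal (n : ℕ) (t : ℝ) (i J : ℕ) : Prop := ∀ x : hcIdx n → ℝ,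
  lmarginal (fun _ => (volume : Measure ℝ)) (hcS n i J)
    (fun x => ENNReal.ofReal (hcPhi n t 0 (n-1) x)) x ≤
    ENNReal.ofReal (4 / t) ^ (hcS n i J).card * ENNReal.ofReal (hcPhi n t i J x)

lemma hcGoal_step (n : ℕ) (t : ℝ) (ht : 0 < t) (ht1 : t ≤ 1) (i J : ℕ) (hJ : i + J + 1 < n)
    (h : hcGoal n t i (J + 1)) : hcGoal n t i J := by
  intro x
  let e : hcIdx n := ⟨(⟨i, by omega⟩, ⟨n - 1 - J, by omega⟩), by
    simp only [Fin.mk_lt_mk]; omega⟩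
  have hS : hcS n i J = insert e (hcS n i (J+1)) := by
    ext f
    simp only [hcS, Finset.mem_insert, Finset.mem_filter, Finset.mem_univ, true_and, e,
      Subtype.ext_iff, Prod.ext_iff, Fin.ext_iff]
    omega
  have hne : e ∉ hcS n i (J+1) := by
    simp only [hcS, Finset.mem_filter, Finset.mem_univ, true_and, e]
    omega
  rw [hS, lmarginal_insert _ (hcPhi_measurable n t 0 (n-1)) hne, Finset.card_insert_of_notMem hne]
  refine (lintegral_mono fun y => h (Function.update x e y)).trans ?_
  have hm := hcPhi_measurable n t i (J+1)
  have hm' : Measurable fun y : ℝ =>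
      ENNReal.ofReal (hcPhi n t i (J + 1) (Function.update x e y)) :=
    hm.comp (measurable_update x)
  rw [lintegral_const_mul _ hm', pow_succ, mul_assoc]
  refine mul_le_mul_right ?_ _
  exact hcPhi_step n t ht ht1 i J e rfl (by simp only [e]; omega) x

lemma hcGoal_row (n : ℕ) (t : ℝ) (ht : 0 < t) (ht1 : t ≤ 1) (i : ℕ) (hi : i < n)
    (h : hcGoal n t i (n - 1 - i)) : ∀ r, r ≤ n - 1 - i → hcGoal n t i (n - 1 - i - r) := by
  intro r
  induction r with
  | zero => intro _; exact h
  | succ r ih =>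
    intro hr
    apply hcGoal_step n t ht ht1 _ _ (by omega)
    have := ih (by omega)
    rwa [show n - 1 - i - r = n - 1 - i - (r+1) + 1 by omega] at this

lemma hcGoal_all (n : ℕ) (hn : 0 < n) (t : ℝ) (ht : 0 < t) (ht1 : t ≤ 1) (i : ℕ) (hi : i < n) :
    hcGoal n t i (n - 1 - i) := by
  induction i with
  | zero =>
    intro x
    have : hcS n 0 (n - 1 - 0) = ∅ := by
      ext f
      have : (f.1.1 : ℕ) < f.1.2 := f.2
      simp only [hcS, Finset.mem_filter, Finset.mem_univ, true_and, Finset.notMem_empty, iff_false]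
      omega
    rw [this]
    simp
  | succ i ih =>
    have h := hcGoal_row n t ht ht1 i (by omega) (ih (by omega)) (n - 1 - i) le_rfl
    rw [Nat.sub_self] at h
    intro x
    have hS : hcS n (i+1) (n - 1 - (i+1)) = hcS n i 0 := by
      ext f
      have : (f.1.1 : ℕ) < f.1.2 := f.2
      have := f.1.2.2
      simp only [hcS, Finset.mem_filter, Finset.mem_univ, true_and]
      omega
    rw [hS, ← hcPhi_next n t i hi]
    exact h x

lemma hc_card (n : ℕ) : Fintype.card (hcIdx n) = n * (n - 1) / 2 := by
  rw [Fintype.card_subtype]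
  rw [← Finset.univ_product_univ, Finset.card_filter, Finset.sum_product]
  have : ∀ i : Fin n, (∑ j : Fin n, if (i, j).1 < (i, j).2 then 1 else 0) = n - 1 - (i:ℕ) := by
    intro i
    rw [← Finset.card_filter]
    have : Finset.univ.filter (fun j : Fin n => (i,j).1 < (i,j).2) = Finset.Ioi i := by
      ext; simp
    rw [this, Fin.card_Ioi]
  rw [Finset.sum_congr rfl fun i _ => this i, ← Finset.sum_range (fun i => n - 1 - i),
    Finset.sum_range_reflect (fun i => i) n, Finset.sum_range_id]

lemma hc_main_bound (n : ℕ) (hn : 0 < n) (t : ℝ) (ht : 0 < t) (ht1 : t ≤ 1) :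
    ∫⁻ x : hcIdx n → ℝ, ENNReal.ofReal
      (∏ m ∈ Finset.range (n-1), hcD n 0 (m + 1) x ^ (-(1 + t) / 2)) ≤
      ENNReal.ofReal ((4 / t) ^ (n * (n - 1) / 2)) := by
  have h := hcGoal_all n hn t ht ht1 (n-1) (by omega) 0
  have hS : hcS n (n-1) (n - 1 - (n-1)) = Finset.univ := by
    ext f
    have : (f.1.1 : ℕ) < f.1.2 := f.2
    have := f.1.2.2
    simp only [hcS, Finset.mem_filter, Finset.mem_univ, true_and, iff_true]
    omega
  rw [hS, ← lintegral_eq_lmarginal_univ, Finset.card_univ, hc_card] at h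
  have e1 : ∀ x, hcPhi n t 0 (n-1) x =
      ∏ m ∈ Finset.range (n-1), hcD n 0 (m + 1) x ^ (-(1 + t) / 2) := by
    intro x; simp [hcPhi]
  have e2 : hcPhi n t (n-1) (n-1-(n-1)) 0 = 1 := by simp [hcPhi]
  rw [e2, ENNReal.ofReal_one, mul_one, ← ENNReal.ofReal_pow (by positivity)] at h
  simp_rw [e1] at h
  exact h

theorem stmt_10 (n : ℕ) (hn : 2 ≤ n) (ε : ℝ) (hε : 0 < ε) :
    Integrable (fun x : {p : Fin n × Fin n // p.1 < p.2} → ℝ =>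
      (∏ k : Fin (n - 1),
          trailingGram n ((k : ℕ) + 1) (by have := k.isLt; omega) (upperUnipotent n x))
          ^ (-(1 : ℝ) / 2) *
        (1 + (1 / 2) * ∑ k : Fin (n - 1),
          Real.log (trailingGram n ((k : ℕ) + 1) (by have := k.isLt; omega)
            (upperUnipotent n x)))
          ^ (-((n * (n - 1) : ℕ) : ℝ) / 2 - ε)) volume := by
  have hge : ∀ (x : hcIdx n → ℝ) (k : Fin (n-1)), 1 ≤ hcD n 0 ((k:ℕ) + 1) x := fun x k => by
    have := k.isLt
    exact hcD_ge_one n 0 _ (by omega) x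
  simp_rw [hcD_eq]
  set d : ℕ := n * (n - 1) / 2 with hd
  have hdd : ((n * (n - 1) : ℕ) : ℝ) = 2 * (d : ℝ) := by
    have : 2 * d = n * (n - 1) := Nat.mul_div_cancel' (Nat.even_mul_pred_self n).two_dvd
    rw [← this]; push_cast; ring
  set a : ℝ := d + ε with ha
  have ha0 : 0 < a := by positivity
  have hexp : -((n * (n - 1) : ℕ) : ℝ) / 2 - ε = -a := by rw [hdd, ha]; ring
  rw [hexp]
  set P : (hcIdx n → ℝ) → ℝ := fun x => ∏ k : Fin (n-1), hcD n 0 ((k:ℕ) + 1) x with hP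
  set L : (hcIdx n → ℝ) → ℝ := fun x =>
    (1 / 2) * ∑ k : Fin (n-1), Real.log (hcD n 0 ((k:ℕ) + 1) x) with hL
  have hL0 : ∀ x, 0 ≤ L x := fun x =>
    mul_nonneg (by norm_num) (Finset.sum_nonneg fun k _ => Real.log_nonneg (hge x k))
  have hP0 : ∀ x, 0 < P x := fun x =>
    Finset.prod_pos fun k _ => zero_lt_one.trans_le (hge x k)
  have hmD := fun i k => (hcD_continuous n i k).measurable
  have hPm : Measurable P := by
    rw [hP]; fun_prop
  have hLm : Measurable L := by
    rw [hL]
    refine Measurable.const_mul (Finset.measurable_fun_sum _ fun k _ => ?_) _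
    exact Real.measurable_log.comp (hmD _ _)
  have hLP : ∀ x, L x = (1/2) * Real.log (P x) := fun x => by
    simp only [hL, hP]
    rw [Real.log_prod fun k _ => (zero_lt_one.trans_le (hge x k)).ne']
  have hcomb : ∀ x s, P x ^ (-(1:ℝ)/2) * Real.exp (-(s * L x)) =
      ∏ m ∈ Finset.range (n-1), hcD n 0 (m + 1) x ^ (-(1 + s) / 2) := by
    intro x s
    rw [Finset.prod_range, Real.finsetProd_rpow _ _ fun k _ => zero_le_one.trans (hge x k)]
    change _ = P x ^ _
    rw [hLP, Real.rpow_def_of_pos (hP0 x), Real.rpow_def_of_pos (hP0 x), ← Real.exp_add]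
    congr 1; ring
  change Integrable (fun x => P x ^ (-(1:ℝ)/2) * (1 + L x) ^ (-a)) volume
  have hmeas : Measurable fun x => P x ^ (-(1:ℝ)/2) * (1 + L x) ^ (-a) := by fun_prop
  refine ⟨hmeas.aestronglyMeasurable, ?_⟩
  rw [hasFiniteIntegral_iff_ofReal (Filter.Eventually.of_forall fun x =>
    mul_nonneg (Real.rpow_nonneg (hP0 x).le _) (Real.rpow_nonneg (by linarith [hL0 x]) _))]
  have hK : Measurable (Function.uncurry fun (x : hcIdx n → ℝ) (s : ℝ) =>
      ENNReal.ofReal (s ^ (a - 1) * (P x ^ (-(1:ℝ)/2) * Real.exp (-(s * L x))))) := by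
    have h1 : Measurable fun p : (hcIdx n → ℝ) × ℝ => P p.1 := hPm.comp measurable_fst
    have h2 : Measurable fun p : (hcIdx n → ℝ) × ℝ => L p.1 := hLm.comp measurable_fst
    unfold Function.uncurry
    fun_prop
  calc ∫⁻ x, ENNReal.ofReal (P x ^ (-(1:ℝ)/2) * (1 + L x) ^ (-a))
      ≤ ∫⁻ x, ENNReal.ofReal (a * Real.exp 1) * ∫⁻ s in Set.Ioc (0:ℝ) 1,
        ENNReal.ofReal (s ^ (a - 1) * (P x ^ (-(1:ℝ)/2) * Real.exp (-(s * L x)))) := by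
        refine lintegral_mono fun x => ?_
        have hp := Real.rpow_nonneg (hP0 x).le (-(1:ℝ)/2)
        dsimp only
        rw [ENNReal.ofReal_mul hp]
        refine (mul_le_mul_right (hc_gamma a (L x) ha0 (hL0 x)) _).trans ?_
        rw [mul_left_comm, ← lintegral_const_mul _ (by fun_prop)]
        refine mul_le_mul_right (lintegral_mono fun s => ?_) _
        rw [← ENNReal.ofReal_mul hp]
        exact ENNReal.ofReal_le_ofReal (le_of_eq (by ring))
    _ = ENNReal.ofReal (a * Real.exp 1) * ∫⁻ s in Set.Ioc (0:ℝ) 1, ∫⁻ x,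
        ENNReal.ofReal (s ^ (a - 1) * (P x ^ (-(1:ℝ)/2) * Real.exp (-(s * L x)))) := by
        rw [lintegral_const_mul _ hK.lintegral_prod_right, lintegral_lintegral_swap hK.aemeasurable]
    _ ≤ ENNReal.ofReal (a * Real.exp 1) * ∫⁻ s in Set.Ioc (0:ℝ) 1,
        ENNReal.ofReal (4 ^ d * s ^ (ε - 1)) := by
        refine mul_le_mul_right (setLIntegral_mono' measurableSet_Ioc fun s hs => ?_) _
        have hs0 : 0 < s := hs.1
        simp_rw [hcomb, ENNReal.ofReal_mul (Real.rpow_nonneg hs0.le (a-1))]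
        rw [lintegral_const_mul _ (by fun_prop)]
        refine (mul_le_mul_right (hc_main_bound n (by omega) s hs0 hs.2) _).trans ?_
        rw [← ENNReal.ofReal_mul (by positivity)]
        apply ENNReal.ofReal_le_ofReal
        apply le_of_eq
        rw [← hd, div_pow, show a - 1 = (ε - 1) + (d : ℝ) by rw [ha]; ring, Real.rpow_add hs0,
          Real.rpow_natCast]
        field_simp
    _ < ⊤ := ENNReal.mul_lt_top ENNReal.ofReal_lt_top (hc_eps_int _ ε hε)
end

section
/- Let n ≥ 3. Parametrize the group [N_n, N_n] of upper triangular n×n real matrices with ones on the diagonal and zeros on the first superdiagonal by the entries x = (x_{ij})_{1 ≤ i, i+2 ≤ j ≤ n} ∈ ℝ^{(n-1)(n-2)/2}, writing u(x) for the corresponding matrix. For 1 ≤ k ≤ n-1 let G_k(x) denote the k-th trailing Gram determinant of u(x). Then for every real number α with 0 ≤ α < 1 and every real number r, the integral ∫_{ℝ^{(n-1)(n-2)/2}} (∏_{k=1}^{n-1} G_k(x))^{-1/2} · G_1(x)^{α/2} · (1 + (1/2) Σ_{k=1}^{n-1} log G_k(x))^{r} dx is finite. -/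
open MeasureTheory

/-- The upper triangular unipotent matrix, with ones on the diagonal, zeros on the
first superdiagonal, and entries in columns `j ≥ i + 2` given by `x`. -/
def commUnipotent (n : ℕ) (x : {p : Fin n × Fin n // (p.1 : ℕ) + 1 < (p.2 : ℕ)} → ℝ) :
    Matrix (Fin n) (Fin n) ℝ :=
  Matrix.of fun i j : Fin n =>
    if h : (i : ℕ) + 1 < (j : ℕ) then x ⟨(i, j), h⟩ else if i = j then 1 else 0


namespace Tame

/-- trailing embedding -/
def tr (n k : ℕ) (hk : k ≤ n) (p : Fin k) : Fin n := ⟨n - k + (p : ℕ), by have := p.isLt; omega⟩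

lemma tr_inj (n k : ℕ) (hk : k ≤ n) : Function.Injective (tr n k hk) := by
  intro p q h
  simp only [tr, Fin.mk.injEq] at h
  ext; omega

lemma sum_tr (n k : ℕ) (hk : k ≤ n) (f : Fin n → ℝ) :
    ∑ p, f (tr n k hk p) = ∑ i with n - k ≤ (i : Fin n).val, f i := by
  have h0 := Finset.sum_map Finset.univ ⟨tr n k hk, tr_inj n k hk⟩ f
  simp only [Function.Embedding.coeFn_mk] at h0
  rw [← h0]
  apply Finset.sum_congr _ (fun _ _ => rfl)
  ext i
  simp only [Finset.mem_map, Finset.mem_univ, true_and, Function.Embedding.coeFn_mk,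
    Finset.mem_filter]
  constructor
  · rintro ⟨p, rfl⟩; simp [tr]
  · intro h
    exact ⟨⟨i - (n - k), by have := i.isLt; omega⟩, by ext; simp [tr]; omega⟩

lemma tg_eq (n k : ℕ) (hk : k ≤ n) (M : Matrix (Fin n) (Fin n) ℝ) :
    trailingGram n k hk M = ((M.transpose * M).submatrix (tr n k hk) (tr n k hk)).det := by
  rfl

lemma mul_lower_sub {l : Type*} (n k : ℕ) (hk : k ≤ n) (L : Matrix (Fin n) (Fin n) ℝ)
    (hL : ∀ i j, i < j → L i j = 0) (X : Matrix l (Fin n) ℝ) :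
    (X * L).submatrix id (tr n k hk) =
      X.submatrix id (tr n k hk) * L.submatrix (tr n k hk) (tr n k hk) := by
  ext a q
  simp only [Matrix.submatrix_apply, Matrix.mul_apply, id]
  rw [sum_tr n k hk (fun i => X a i * L i (tr n k hk q)), Finset.sum_filter]
  apply Finset.sum_congr rfl
  intro i _
  split_ifs with h
  · rfl
  · rw [hL i _ (by rw [Fin.lt_def]; simp only [tr]; omega), mul_zero]

/-- Conjugating by a lower triangular matrix. -/
lemma conj_lower_sub (n k : ℕ) (hk : k ≤ n) (L : Matrix (Fin n) (Fin n) ℝ)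
    (hL : ∀ i j, i < j → L i j = 0) (X : Matrix (Fin n) (Fin n) ℝ) :
    ((L.transpose * X * L).submatrix (tr n k hk) (tr n k hk)).det =
      (L.submatrix (tr n k hk) (tr n k hk)).det ^ 2 *
        (X.submatrix (tr n k hk) (tr n k hk)).det := by
  have h1 := mul_lower_sub n k hk L hL (L.transpose * X)
  have h2 := mul_lower_sub n k hk L hL X.transpose
  have h3 : (L.transpose * X * L).submatrix (tr n k hk) (tr n k hk) =
      (L.submatrix (tr n k hk) (tr n k hk)).transpose * X.submatrix (tr n k hk) (tr n k hk) *
        L.submatrix (tr n k hk) (tr n k hk) := by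
    have e1 : (L.transpose * X * L).submatrix (tr n k hk) (tr n k hk) =
      ((L.transpose * X * L).submatrix id (tr n k hk)).submatrix (tr n k hk) id := rfl
    rw [e1, h1, Matrix.submatrix_mul _ _ _ id _ Function.bijective_id]
    congr 1
    ext a b
    have e2 := congrFun (congrFun h2 (tr n k hk b)) a
    simp only [Matrix.submatrix_apply, Matrix.mul_apply, Matrix.transpose_apply, id] at e2 ⊢
    simpa only [mul_comm] using e2
  rw [h3, Matrix.det_mul, Matrix.det_mul, Matrix.det_transpose]
  ring

lemma chol : ∀ (n : ℕ) (S : Matrix (Fin n) (Fin n) ℝ), S.PosDef →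
    ∃ L : Matrix (Fin n) (Fin n) ℝ, (∀ i j, i < j → L i j = 0) ∧ L.transpose * L = S := by
  intro n
  induction n with
  | zero => intro S _; exact ⟨0, fun i => i.elim0, Subsingleton.elim _ _⟩
  | succ n ih =>
    intro S hS
    obtain ⟨L, hL, hLS⟩ := ih (S.submatrix Fin.succ Fin.succ)
      (hS.submatrix (Fin.succ_injective n))
    have hdet : IsUnit L.det := by
      have := (hS.submatrix (Fin.succ_injective n)).det_pos
      rw [← hLS, Matrix.det_mul] at this
      rw [isUnit_iff_ne_zero]
      intro h; rw [h] at this; simp at this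
    set v : Fin n → ℝ := fun i => S i.succ 0 with hv
    have hsymm : ∀ i j, S i j = S j i := fun i j => by
      have := hS.isHermitian.apply i j
      simpa using this.symm
    set l : Fin n → ℝ := (L.transpose)⁻¹.mulVec v with hl
    have hlv : L.transpose.mulVec l = v := by
      rw [hl, Matrix.mulVec_mulVec, Matrix.mul_nonsing_inv _ (by rwa [Matrix.det_transpose]),
        Matrix.one_mulVec]
    set y : Fin n → ℝ := L⁻¹.mulVec l with hy
    have hLy : L.mulVec y = l := by
      rw [hy, Matrix.mulVec_mulVec, Matrix.mul_nonsing_inv _ hdet, Matrix.one_mulVec]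
    have hpos : 0 ≤ S 0 0 - l ⬝ᵥ l := by
      have h0 := hS.posSemidef.dotProduct_mulVec_nonneg (Fin.cons 1 (-y) : Fin (n+1) → ℝ)
      have hyv : y ⬝ᵥ v = l ⬝ᵥ l := by
        rw [← hlv, Matrix.dotProduct_mulVec, Matrix.vecMul_transpose, hLy]
      have hyS : y ⬝ᵥ (S.submatrix Fin.succ Fin.succ).mulVec y = l ⬝ᵥ l := by
        rw [← hLS, ← Matrix.mulVec_mulVec, hLy, Matrix.dotProduct_mulVec, Matrix.vecMul_transpose,
          hLy]
      have e : star (Fin.cons 1 (-y) : Fin (n+1) → ℝ) ⬝ᵥ S.mulVec (Fin.cons 1 (-y)) =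
          S 0 0 - 2 * (y ⬝ᵥ v) + y ⬝ᵥ (S.submatrix Fin.succ Fin.succ).mulVec y := by
        simp only [dotProduct, Matrix.mulVec, Fin.sum_univ_succ, star_trivial, Fin.cons_zero,
          Fin.cons_succ, Matrix.submatrix_apply, Pi.neg_apply, hv]
        simp only [mul_neg, mul_one, one_mul, Finset.sum_neg_distrib, neg_mul, mul_add,
          Finset.sum_add_distrib, hsymm 0 (Fin.succ _)]
        have : ∑ x, S (Fin.succ x) 0 * y x = ∑ x, y x * S (Fin.succ x) 0 :=
          Finset.sum_congr rfl (fun _ _ => mul_comm _ _)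
        rw [this]; ring
      rw [e, hyv, hyS] at h0
      linarith
    refine ⟨Matrix.of fun i j => Fin.cases (Fin.cases (√(S 0 0 - l ⬝ᵥ l)) (fun _ => 0) j)
      (fun i' => Fin.cases (l i') (fun j' => L i' j') j) i, ?_, ?_⟩
    · intro i j
      refine Fin.cases ?_ (fun i' => ?_) i <;> refine Fin.cases ?_ (fun j' => ?_) j
      · simp
      · simp
      · simp
      · intro h; simpa using hL i' j' (by simpa using h)
    · have hlv' : ∀ i, ∑ x, L x i * l x = S i.succ 0 := fun i => congrFun hlv i
      have hLS' : ∀ i j, ∑ x, L x i * L x j = S i.succ j.succ := fun i j =>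
        congrFun (congrFun hLS i) j
      ext i j
      rw [Matrix.mul_apply, Fin.sum_univ_succ]
      refine Fin.cases ?_ (fun i' => ?_) i <;> refine Fin.cases ?_ (fun j' => ?_) j
      · simp only [Matrix.transpose_apply, Matrix.of_apply, Fin.cases_zero, Fin.cases_succ]
        rw [Real.mul_self_sqrt hpos]
        simp [dotProduct]
      · simp only [Matrix.transpose_apply, Matrix.of_apply, Fin.cases_zero, Fin.cases_succ]
        rw [hsymm 0 j'.succ]; refine Eq.trans ?_ (hlv' j'); simp [mul_comm]
      · simp only [Matrix.transpose_apply, Matrix.of_apply, Fin.cases_zero, Fin.cases_succ]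
        rw [← hlv' i']; simp
      · simp only [Matrix.transpose_apply, Matrix.of_apply, Fin.cases_zero, Fin.cases_succ]
        rw [← hLS']; simp

/-- index type of the coordinates -/
abbrev Idx (n : ℕ) := {p : Fin n × Fin n // (p.1 : ℕ) + 1 < (p.2 : ℕ)}

/-- the first row plus the rest -/
def idxFun (m : ℕ) : Fin m ⊕ Idx (m + 1) → Idx (m + 2)
  | Sum.inl j => ⟨(0, j.succ.succ), by simp⟩
  | Sum.inr p => ⟨(p.1.1.succ, p.1.2.succ), by simpa using p.2⟩

lemma idxFun_bij (m : ℕ) : Function.Bijective (idxFun m) := by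
  constructor
  · rintro (a | ⟨⟨a, b⟩, h⟩) (c | ⟨⟨c, d⟩, h'⟩) e
    · simpa [idxFun] using e
    · simp only [idxFun, Subtype.mk.injEq, Prod.mk.injEq] at e
      exact absurd e.1.symm (Fin.succ_ne_zero _)
    · simp only [idxFun, Subtype.mk.injEq, Prod.mk.injEq] at e
      exact absurd e.1 (Fin.succ_ne_zero _)
    · simpa [idxFun] using e
  · rintro ⟨⟨i, j⟩, h⟩
    simp only at h
    induction i using Fin.cases with
    | zero =>
      induction j using Fin.cases with
      | zero => simp at h
      | succ j =>
        obtain _ | m := m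
        · have := j.isLt; simp at h
        induction j using Fin.cases with
        | zero => simp at h
        | succ j => exact ⟨Sum.inl j, rfl⟩
    | succ i =>
      induction j using Fin.cases with
      | zero => simp at h
      | succ j => exact ⟨Sum.inr ⟨(i, j), by simpa using h⟩, rfl⟩

noncomputable def idxEquiv (m : ℕ) : Fin m ⊕ Idx (m + 1) ≃ Idx (m + 2) :=
  Equiv.ofBijective (idxFun m) (idxFun_bij m)

/-- assemble coordinates -/
noncomputable def asm (m : ℕ) : ((Fin m → ℝ) × (Idx (m + 1) → ℝ)) ≃ᵐ (Idx (m + 2) → ℝ) :=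
  (MeasurableEquiv.sumPiEquivProdPi (fun _ : Fin m ⊕ Idx (m + 1) => ℝ)).symm.trans
    (MeasurableEquiv.piCongrLeft (fun _ => ℝ) (idxEquiv m))

lemma asm_mp (m : ℕ) : MeasurePreserving (asm m) volume volume :=
  (volume_measurePreserving_sumPiEquivProdPi_symm (fun _ : Fin m ⊕ Idx (m + 1) => ℝ)).trans
    (volume_measurePreserving_piCongrLeft (fun _ => ℝ) (idxEquiv m))

lemma asm_apply (m : ℕ) (z : Fin m → ℝ) (x : Idx (m + 1) → ℝ) (q : Fin m ⊕ Idx (m + 1)) :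
    asm m (z, x) (idxFun m q) = Sum.elim z x q := by
  have h := MeasurableEquiv.piCongrLeft_apply_apply (idxEquiv m) (β := fun _ => ℝ)
    ((MeasurableEquiv.sumPiEquivProdPi (fun _ : Fin m ⊕ Idx (m + 1) => ℝ)).symm (z, x)) q
  refine Eq.trans h ?_
  cases q <;> rfl

lemma cu_zero_succ (m : ℕ) (z : Fin m → ℝ) (x : Idx (m + 1) → ℝ) (j : Fin (m + 1)) :
    commUnipotent (m + 2) (asm m (z, x)) 0 j.succ = (Fin.cons 0 z : Fin (m + 1) → ℝ) j := by
  induction j using Fin.cases with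
  | zero => simp [commUnipotent]
  | succ j =>
    have := asm_apply m z x (Sum.inl j)
    simp only [commUnipotent, Matrix.of_apply, Fin.cons_succ]
    rw [dif_pos (by simp)]
    exact this

lemma cu_succ_succ (m : ℕ) (z : Fin m → ℝ) (x : Idx (m + 1) → ℝ) (i j : Fin (m + 1)) :
    commUnipotent (m + 2) (asm m (z, x)) i.succ j.succ = commUnipotent (m + 1) x i j := by
  simp only [commUnipotent, Matrix.of_apply, Fin.val_succ, Fin.succ_inj]
  by_cases h : (i : ℕ) + 1 < j
  · rw [dif_pos (by omega), dif_pos h]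
    exact asm_apply m z x (Sum.inr ⟨(i, j), h⟩)
  · rw [dif_neg (by omega), dif_neg h]

lemma cu_det (n : ℕ) (x : Idx n → ℝ) : (commUnipotent n x).det = 1 := by
  rw [Matrix.det_of_isUpperTriangular]
  · simp [commUnipotent]
  · intro i j h
    simp only [id, Fin.lt_def] at h
    simp only [commUnipotent, Matrix.of_apply]
    rw [dif_neg (by omega), if_neg (by rintro rfl; omega)]

lemma cu_posDef (n : ℕ) (x : Idx n → ℝ) :
    ((commUnipotent n x).transpose * commUnipotent n x).PosDef := by
  have := Matrix.PosDef.conjTranspose_mul_self (commUnipotent n x)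
    (Matrix.mulVec_injective_iff_isUnit.2 ((Matrix.isUnit_iff_isUnit_det _).2 (by
      rw [cu_det]; exact isUnit_one)))
  rwa [Matrix.conjTranspose_eq_transpose_of_trivial] at this

lemma tg_full (n : ℕ) (x : Idx n → ℝ) : trailingGram n n le_rfl (commUnipotent n x) = 1 := by
  have : tr n n le_rfl = id := by ext p; simp [tr]
  rw [tg_eq, this, Matrix.submatrix_id_id, Matrix.det_mul, Matrix.det_transpose, cu_det, one_mul]

/-- Data attached to a Cholesky factor. -/
structure IsChol {n : ℕ} (x : Idx n → ℝ) (L : Matrix (Fin n) (Fin n) ℝ) : Prop where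
  low : ∀ i j, i < j → L i j = 0
  eq : L.transpose * L = (commUnipotent n x).transpose * commUnipotent n x

lemma exists_chol {n : ℕ} (x : Idx n → ℝ) : ∃ L, IsChol x L := by
  obtain ⟨L, h1, h2⟩ := chol n _ (cu_posDef n x)
  exact ⟨L, h1, h2⟩

lemma IsChol.tg {n : ℕ} {x : Idx n → ℝ} {L : Matrix (Fin n) (Fin n) ℝ} (h : IsChol x L)
    (k : ℕ) (hk : k ≤ n) :
    trailingGram n k hk (commUnipotent n x) = (L.submatrix (tr n k hk) (tr n k hk)).det ^ 2 := by
  have := conj_lower_sub n k hk L h.low 1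
  rw [tg_eq, ← h.eq]
  rw [Matrix.mul_one, Matrix.submatrix_one _ (tr_inj n k hk), Matrix.det_one, mul_one] at this
  exact this

lemma IsChol.det_sq {n : ℕ} {x : Idx n → ℝ} {L : Matrix (Fin n) (Fin n) ℝ} (h : IsChol x L) :
    L.det ^ 2 = 1 := by
  have := congrArg Matrix.det h.eq
  rw [Matrix.det_mul, Matrix.det_mul, Matrix.det_transpose, Matrix.det_transpose, cu_det] at this
  rw [sq, this, one_mul]

lemma tr_succ (m k : ℕ) (hk : k ≤ m + 1) (hk' : k ≤ m + 2) (p : Fin k) :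
    tr (m + 2) k hk' p = (tr (m + 1) k hk p).succ := by
  ext; simp [tr]; omega

lemma IsChol.step {m : ℕ} {x : Idx (m + 1) → ℝ} {L : Matrix (Fin (m + 1)) (Fin (m + 1)) ℝ}
    (h : IsChol x L) (z : Fin m → ℝ) (s : Fin (m + 1) → ℝ)
    (hs : Matrix.vecMul s L = (Fin.cons 0 z : Fin (m + 1) → ℝ)) (k : ℕ) (hk : k ≤ m + 1)
    (hk' : k ≤ m + 2) :
    trailingGram (m + 2) k hk' (commUnipotent (m + 2) (asm m (z, x))) =
      trailingGram (m + 1) k hk (commUnipotent (m + 1) x) *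
        (1 + ∑ i with m + 1 - k ≤ (i : Fin (m + 1)).val, s i ^ 2) := by
  rw [h.tg k hk, ← sum_tr (m + 1) k hk (fun i => s i ^ 2)]
  have key : (((commUnipotent (m + 2) (asm m (z, x))).transpose *
      commUnipotent (m + 2) (asm m (z, x))).submatrix Fin.succ Fin.succ) =
      L.transpose * (1 + Matrix.vecMulVec s s) * L := by
    rw [Matrix.mul_add, Matrix.add_mul, Matrix.mul_one, h.eq, Matrix.mul_vecMulVec,
      Matrix.vecMulVec_mul, Matrix.mulVec_transpose, hs]
    ext i j
    simp only [Matrix.submatrix_apply, Matrix.mul_apply, Matrix.transpose_apply,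
      Fin.sum_univ_succ (n := m + 1), Matrix.add_apply, Matrix.vecMulVec_apply, cu_zero_succ,
      cu_succ_succ]
    ring
  have e : tr (m + 2) k hk' = Fin.succ ∘ tr (m + 1) k hk := by
    funext p; exact tr_succ m k hk hk' p
  rw [tg_eq, e, ← Matrix.submatrix_submatrix, key, conj_lower_sub _ _ _ _ h.low]
  congr 1
  have e2 : (1 + Matrix.vecMulVec s s).submatrix (tr (m + 1) k hk) (tr (m + 1) k hk) =
      1 + Matrix.replicateCol Unit (s ∘ tr (m + 1) k hk) *
        Matrix.replicateRow Unit (s ∘ tr (m + 1) k hk) := by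
    rw [Matrix.submatrix_add, Pi.add_apply, Pi.add_apply,
      Matrix.submatrix_one _ (tr_inj _ _ _)]
    congr 1
    ext i j
    simp [Matrix.vecMulVec_apply, Matrix.mul_apply]
  rw [e2, Matrix.det_one_add_replicateCol_mul_replicateRow]
  simp [dotProduct, sq]

/-- The solution `s` of `s L = (0, z)`. -/
noncomputable def sol {m : ℕ} (L : Matrix (Fin (m + 1)) (Fin (m + 1)) ℝ) (z : Fin m → ℝ) :
    Fin (m + 1) → ℝ := Matrix.vecMul (Fin.cons 0 z : Fin (m + 1) → ℝ) L⁻¹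

lemma IsChol.unit {n : ℕ} {x : Idx n → ℝ} {L : Matrix (Fin n) (Fin n) ℝ} (h : IsChol x L) :
    IsUnit L.det := by
  have := h.det_sq
  rw [isUnit_iff_ne_zero]; intro h0; rw [h0] at this; simp at this

lemma IsChol.sol_mul {m : ℕ} {x : Idx (m + 1) → ℝ} {L : Matrix (Fin (m + 1)) (Fin (m + 1)) ℝ}
    (h : IsChol x L) (z : Fin m → ℝ) :
    Matrix.vecMul (sol L z) L = (Fin.cons 0 z : Fin (m + 1) → ℝ) := by
  rw [sol, Matrix.vecMul_vecMul, Matrix.nonsing_inv_mul _ h.unit, Matrix.vecMul_one]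

/-- The first column of `L` is a unit vector. -/
lemma IsChol.col {m : ℕ} {x : Idx (m + 1) → ℝ} {L : Matrix (Fin (m + 1)) (Fin (m + 1)) ℝ}
    (h : IsChol x L) : ∑ i, L i 0 ^ 2 = 1 := by
  have := congrFun (congrFun h.eq 0) 0
  simp only [Matrix.mul_apply, Matrix.transpose_apply, Fin.sum_univ_succ (n := m)
    (f := fun i => commUnipotent (m + 1) x i 0 * commUnipotent (m + 1) x i 0)] at this
  simp only [sq, this]
  simp [commUnipotent, Fin.succ_ne_zero]

/-- Coordinates other than `i` as a function of `z`. -/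
lemma IsChol.minor {m : ℕ} {x : Idx (m + 1) → ℝ} {L : Matrix (Fin (m + 1)) (Fin (m + 1)) ℝ}
    (h : IsChol x L) (i : Fin (m + 1)) :
    |((L⁻¹).submatrix Fin.succ i.succAbove).det| = |L i 0| := by
  have h1 := Matrix.adjugate_fin_succ_eq_det_submatrix L⁻¹ i 0
  have h2 : (L⁻¹).adjugate = (L⁻¹).det • L := by
    have h3 := Matrix.adjugate_mul L⁻¹
    calc (L⁻¹).adjugate = (L⁻¹).adjugate * (L⁻¹ * L) := by
          rw [Matrix.nonsing_inv_mul _ h.unit, Matrix.mul_one]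
      _ = (L⁻¹).det • L := by
          rw [← Matrix.mul_assoc, h3, Matrix.smul_mul, Matrix.one_mul]
  have h4 : |(L⁻¹).det| = 1 := by
    rw [Matrix.det_nonsing_inv, Ring.inverse_eq_inv', abs_inv]
    have := h.det_sq
    rw [← sq_abs] at this
    rw [(pow_eq_one_iff_of_nonneg (abs_nonneg _) two_ne_zero).1 this, inv_one]
  rw [h2] at h1
  have h5 := congrArg abs h1
  simp only [Matrix.smul_apply, smul_eq_mul, abs_mul, h4, one_mul, abs_pow, abs_neg, abs_one,
    one_pow] at h5
  rw [h5]
  congr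

lemma sol_succAbove {m : ℕ} (L : Matrix (Fin (m + 1)) (Fin (m + 1)) ℝ) (z : Fin m → ℝ)
    (i : Fin (m + 1)) (j : Fin m) :
    sol L z (i.succAbove j) =
      Matrix.toLin' ((L⁻¹).submatrix Fin.succ i.succAbove).transpose z j := by
  simp only [sol, Matrix.vecMul, Matrix.toLin'_apply, Matrix.mulVec, dotProduct,
    Fin.sum_univ_succ, Fin.cons_zero, Fin.cons_succ, zero_mul, zero_add, Matrix.transpose_apply,
    Matrix.submatrix_apply]
  exact Finset.sum_congr rfl (fun _ _ => mul_comm _ _)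

/-- The top left entry. -/
lemma IsChol.corner {m : ℕ} {x : Idx (m + 1) → ℝ} {L : Matrix (Fin (m + 1)) (Fin (m + 1)) ℝ}
    (h : IsChol x L) :
    L 0 0 ^ 2 * trailingGram (m + 1) m (by omega) (commUnipotent (m + 1) x) = 1 := by
  rw [h.tg]
  have e : tr (m + 1) m (by omega) = Fin.succ := by
    funext p; ext; simp [tr]; omega
  rw [e, ← h.det_sq, Matrix.det_succ_row_zero, Fin.sum_univ_succ, Finset.sum_eq_zero]
  · simp; ring_nf
  · intro j _
    rw [h.low 0 j.succ (Fin.succ_pos j)]; simp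

lemma tg_ge_one : ∀ (m k : ℕ) (hk : k ≤ m + 1) (x : Idx (m + 1) → ℝ),
    1 ≤ trailingGram (m + 1) k hk (commUnipotent (m + 1) x) := by
  intro m
  induction m with
  | zero =>
    intro k hk x
    obtain rfl | rfl : k = 0 ∨ k = 1 := by omega
    · simp [trailingGram]
    · rw [tg_full]
  | succ m ih =>
    intro k hk x
    rcases Nat.lt_or_ge k (m + 2) with hk' | hk'
    · obtain ⟨⟨z, y⟩, rfl⟩ := (asm m).surjective x
      obtain ⟨L, hL⟩ := exists_chol y
      rw [hL.step z _ (hL.sol_mul z) k (by omega) hk]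
      have h1 := ih k (by omega) y
      have h2 : 0 ≤ ∑ i with m + 1 - k ≤ (i : Fin (m + 1)).val, sol L z i ^ 2 :=
        Finset.sum_nonneg (fun _ _ => sq_nonneg _)
      nlinarith
    · obtain rfl : k = m + 2 := by omega
      rw [tg_full]

/-- The one-variable decay function. -/
noncomputable def phi (κ s : ℝ) : ℝ := (1 + s ^ 2) ^ (-(1 + κ) / 2)

lemma phi_pos (κ s : ℝ) : 0 < phi κ s := by unfold phi; positivity

/-- Linear-programming core in logarithmic coordinates. -/
lemma log_core {N : ℕ} (τ t : Fin (N + 1) → ℝ) (α θ κ : ℝ) (hα0 : 0 ≤ α)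
    (hθ : 0 < θ) (hαθ : α + θ ≤ 1) (hκ : 2 * κ * (N + 1) = θ)
    (ht : ∀ j, 0 ≤ t j) (htτ : ∀ j, t j ≤ τ j) (ht0 : ∀ j, t j ≤ τ 0)
    (hτ0 : ∀ j, τ j ≤ τ 0) (hτl : ∀ j, τ (Fin.last N) ≤ τ j) (i : Fin (N + 1)) :
    (1 + κ) * ((1 - θ) * (∑ j, t j - t i) + θ * (∑ j, t j - t 0)) ≤
      ∑ j, (1 - κ) * τ j - α * τ (Fin.last N) := by
  have hκ0 : 0 < κ := by
    by_contra hc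
    push Not at hc
    have : (0:ℝ) < N + 1 := by positivity
    nlinarith
  have hl0 : 0 ≤ τ (Fin.last N) := (ht _).trans (htτ _)
  have h1 : ∑ j, τ j ≤ (N + 1) * τ 0 := by
    calc ∑ j, τ j ≤ ∑ _j : Fin (N + 1), τ 0 := Finset.sum_le_sum (fun j _ => hτ0 j)
      _ = _ := by simp
  have h2 : ∑ j, t j ≤ (N + 1) * τ 0 := by
    calc ∑ j, t j ≤ ∑ _j : Fin (N + 1), τ 0 := Finset.sum_le_sum (fun j _ => ht0 j)
      _ = _ := by simp
  have h3 : 0 ≤ ∑ j, (τ j - (t j - (if j = i then (1 - θ) * t i else 0)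
      - (if j = 0 then θ * t 0 else 0)) - (if j = i then α * τ (Fin.last N) else 0)
      - (if j = 0 then θ * τ 0 else 0)) := by
    apply Finset.sum_nonneg
    intro j _
    have a1 := htτ j
    have a2 := hτl j
    have a3 := ht j
    have a4 := hτ0 j
    have a5 := mul_le_mul_of_nonneg_left a2 hα0
    have a6 := mul_le_mul_of_nonneg_left a1 hθ.le
    have a7 : 0 ≤ (1 - α - θ) * τ j := mul_nonneg (by linarith) (a3.trans a1)
    have a8 : 0 ≤ (1 - θ) * (τ j - t j) := mul_nonneg (by linarith) (by linarith)
    by_cases hi : j = i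
    · subst hi
      by_cases h0 : j = 0
      · subst h0; simp only [if_true]; nlinarith
      · simp only [if_true, if_neg h0]; nlinarith
    · by_cases h0 : j = 0
      · subst h0; simp only [if_true, if_neg hi]; nlinarith
      · simp only [if_neg hi, if_neg h0]; nlinarith
  simp only [Finset.sum_sub_distrib, Finset.sum_ite_eq', Finset.mem_univ, if_true] at h3
  rw [← Finset.mul_sum]
  have h4 : 0 ≤ (1 - θ) * t i + θ * t 0 :=
    add_nonneg (mul_nonneg (by linarith) (ht i)) (mul_nonneg hθ.le (ht 0))
  have h5 := mul_le_mul_of_nonneg_left h1 hκ0.le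
  have h6 := mul_le_mul_of_nonneg_left h2 hκ0.le
  have h7 := mul_nonneg hκ0.le h4
  have h8 : 2 * κ * (N + 1) * τ 0 = θ * τ 0 := by rw [hκ]
  nlinarith

lemma prod_erase_log {N : ℕ} (s : Fin (N + 1) → ℝ) (κ : ℝ) (i : Fin (N + 1)) :
    ∏ j : Fin N, phi κ (s (i.succAbove j)) =
      Real.exp (-(1 + κ) / 2 * (∑ j, Real.log (1 + s j ^ 2) - Real.log (1 + s i ^ 2))) := by
  rw [Fin.sum_univ_succAbove _ i, add_sub_cancel_left, Finset.mul_sum, Real.exp_sum]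
  apply Finset.prod_congr rfl
  intro j _
  rw [phi, Real.rpow_def_of_pos (by positivity), mul_comm]

lemma pointwise {N : ℕ} (T s a : Fin (N + 1) → ℝ) (α θ κ : ℝ) (hα0 : 0 ≤ α)
    (hθ : 0 < θ) (hαθ : α + θ ≤ 1) (hκ : 2 * κ * (N + 1) = θ)
    (hT : ∀ j, 1 + s j ^ 2 ≤ T j) (hT0 : ∀ j, T j ≤ T 0) (hTl : ∀ j, T (Fin.last N) ≤ T j)
    (ha : ∑ i, a i ^ 2 = 1) :
    |a 0| ^ θ * ((∏ j, T j ^ (-(1:ℝ) / 2 + κ / 2)) * T (Fin.last N) ^ (α / 2)) ≤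
      (N + 1) * ∑ i, |a i| * ∏ j : Fin N, phi κ (s (i.succAbove j)) := by
  have hTpos : ∀ j, 0 < T j := fun j => lt_of_lt_of_le (by positivity) (hT j)
  -- choose a large coordinate
  obtain ⟨i, hi⟩ : ∃ i, 1 ≤ (N + 1) * |a i| := by
    by_contra hc
    push Not at hc
    have hb : ∀ i, (N + 1 : ℝ) * a i ^ 2 < 1 := fun i => by
      have h1 := hc i
      have h0 := abs_nonneg (a i)
      have h2 : (0:ℝ) ≤ N := by positivity
      rw [← sq_abs]
      nlinarith
    have : ∑ i, (N + 1 : ℝ) * a i ^ 2 < ∑ _i : Fin (N + 1), (1:ℝ) :=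
      Finset.sum_lt_sum_of_nonempty Finset.univ_nonempty (fun i _ => hb i)
    rw [← Finset.mul_sum, ha] at this
    simp at this
  set X : Fin (N + 1) → ℝ := fun i => ∏ j : Fin N, phi κ (s (i.succAbove j)) with hX
  have hXpos : ∀ i, 0 < X i := fun i => Finset.prod_pos (fun _ _ => phi_pos _ _)
  have hθ1 : θ ≤ 1 := by linarith
  have main : (∏ j, T j ^ (-(1:ℝ) / 2 + κ / 2)) * T (Fin.last N) ^ (α / 2) ≤
      X i ^ (1 - θ) * X 0 ^ θ := by
    have hl := log_core (fun j => Real.log (T j)) (fun j => Real.log (1 + s j ^ 2)) α θ κ hα0 hθ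
      hαθ hκ (fun j => Real.log_nonneg (by nlinarith [sq_nonneg (s j)]))
      (fun j => Real.log_le_log (by positivity) (hT j))
      (fun j => Real.log_le_log (by positivity) ((hT j).trans (hT0 j)))
      (fun j => Real.log_le_log (hTpos j) (hT0 j))
      (fun j => Real.log_le_log (hTpos _) (hTl j)) i
    have e1 : (∏ j, T j ^ (-(1:ℝ) / 2 + κ / 2)) * T (Fin.last N) ^ (α / 2) =
        Real.exp (-(1/2) * (∑ j, (1 - κ) * Real.log (T j) - α * Real.log (T (Fin.last N)))) := by
      rw [mul_sub, sub_eq_add_neg, Real.exp_add, Finset.mul_sum, Real.exp_sum]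
      congr 1
      · apply Finset.prod_congr rfl
        intro j _
        rw [Real.rpow_def_of_pos (hTpos j)]; ring_nf
      · rw [Real.rpow_def_of_pos (hTpos _)]; ring_nf
    rw [e1, hX]
    simp only [prod_erase_log]
    rw [← Real.exp_mul, ← Real.exp_mul, ← Real.exp_add, Real.exp_le_exp]
    linarith
  have h1 : X i ≤ (N + 1) * (|a i| * X i) := by
    have := mul_le_mul_of_nonneg_right hi (hXpos i).le
    linarith
  have hsum : ∀ k, |a k| * X k ≤ ∑ i, |a i| * X i := fun k =>
    Finset.single_le_sum (f := fun i => |a i| * X i)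
      (fun i _ => mul_nonneg (abs_nonneg _) (hXpos i).le) (Finset.mem_univ k)
  have hN : (0:ℝ) ≤ N := by positivity
  have hA : X i ≤ (N + 1) * ∑ i, |a i| * X i :=
    h1.trans (mul_le_mul_of_nonneg_left (hsum i) (by positivity))
  have hB : |a 0| * X 0 ≤ (N + 1) * ∑ i, |a i| * X i := by
    have := hsum 0
    have h0 : 0 ≤ |a 0| * X 0 := mul_nonneg (abs_nonneg _) (hXpos 0).le
    nlinarith
  have h0 : 0 ≤ |a 0| * X 0 := mul_nonneg (abs_nonneg _) (hXpos 0).le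
  calc |a 0| ^ θ * ((∏ j, T j ^ (-(1:ℝ) / 2 + κ / 2)) * T (Fin.last N) ^ (α / 2))
      ≤ |a 0| ^ θ * (X i ^ (1 - θ) * X 0 ^ θ) :=
        mul_le_mul_of_nonneg_left main (by positivity)
    _ = X i ^ (1 - θ) * (|a 0| * X 0) ^ θ := by
        rw [Real.mul_rpow (abs_nonneg _) (hXpos 0).le]; ring
    _ ≤ (1 - θ) * X i + θ * (|a 0| * X 0) :=
        Real.geom_mean_le_arith_mean2_weighted (by linarith) hθ.le (hXpos i).le h0 (by ring)
    _ ≤ (N + 1) * ∑ i, |a i| * X i := by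
        have p1 := mul_le_mul_of_nonneg_left hA (by linarith : 0 ≤ 1 - θ)
        have p2 := mul_le_mul_of_nonneg_left hB hθ.le
        linarith

/-- The integral of the product decay function. -/
noncomputable def KK (N : ℕ) (κ : ℝ) : ENNReal :=
  ∫⁻ y : Fin N → ℝ, ENNReal.ofReal (∏ j, phi κ (y j))

lemma phi_cont (κ : ℝ) : Continuous (phi κ) := by
  unfold phi
  exact Continuous.rpow_const (by fun_prop) (fun x => Or.inl (by positivity))

lemma KK_lt_top (N : ℕ) (κ : ℝ) (hκ : 0 < κ) : KK N κ < ⊤ := by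
  have h1 : Integrable (phi κ) volume := by
    have := integrable_rpow_neg_one_add_norm_sq (E := ℝ) (μ := volume) (r := 1 + κ)
      (by simp [hκ])
    simp only [Real.norm_eq_abs, sq_abs] at this
    exact this
  have h2 : Integrable (fun y : Fin N → ℝ => ∏ j, phi κ (y j)) volume :=
    Integrable.fintype_prod (f := fun _ => phi κ) (fun _ => h1)
  exact h2.lintegral_lt_top

lemma lin_subst {N : ℕ} (B : Matrix (Fin N) (Fin N) ℝ) (κ : ℝ) :
    ENNReal.ofReal |B.det| * ∫⁻ z : Fin N → ℝ, ENNReal.ofReal (∏ j, phi κ (Matrix.toLin' B z j)) ≤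
      KK N κ := by
  by_cases hB : B.det = 0
  · simp [hB]
  have hmeas : Measurable (fun y : Fin N → ℝ => ENNReal.ofReal (∏ j, phi κ (y j))) := by
    apply Measurable.ennreal_ofReal
    exact (continuous_finsetProd _ (fun j _ => (phi_cont κ).comp (continuous_apply j))).measurable
  have h := Real.map_matrix_volume_pi_eq_smul_volume_pi hB
  have hlin : Measurable (Matrix.toLin' B) :=
    (LinearMap.continuous_of_finiteDimensional (Matrix.toLin' B)).measurable
  rw [← lintegral_map hmeas hlin, h, lintegral_smul_measure, smul_eq_mul, ← mul_assoc,
    ← ENNReal.ofReal_mul (abs_nonneg _), ← abs_mul, mul_inv_cancel₀ hB]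
  simp [KK]

/-- The rank one factors. -/
noncomputable def TT (m : ℕ) (s : Fin (m + 1) → ℝ) (k : Fin (m + 1)) : ℝ :=
  1 + ∑ i with m + 1 - ((k : ℕ) + 1) ≤ (i : Fin (m + 1)).val, s i ^ 2

lemma TT_pos (m : ℕ) (s : Fin (m + 1) → ℝ) (k : Fin (m + 1)) : 0 < TT m s k := by
  unfold TT
  have : 0 ≤ ∑ i with m + 1 - ((k : ℕ) + 1) ≤ (i : Fin (m + 1)).val, s i ^ 2 :=
    Finset.sum_nonneg (fun _ _ => sq_nonneg _)
  linarith

lemma TT_mono (m : ℕ) (s : Fin (m + 1) → ℝ) {k l : Fin (m + 1)} (h : k ≤ l) :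
    TT m s k ≤ TT m s l := by
  unfold TT
  have h' : (k : ℕ) ≤ l := h
  refine add_le_add le_rfl (Finset.sum_le_sum_of_subset_of_nonneg ?_ ?_)
  · intro i; simp only [Finset.mem_filter, Finset.mem_univ, true_and]; omega
  · intro _ _ _; positivity

lemma TT_ge (m : ℕ) (s : Fin (m + 1) → ℝ) (j : Fin (m + 1)) :
    1 + s j ^ 2 ≤ TT m s j.rev := by
  unfold TT
  gcongr
  apply Finset.single_le_sum (f := fun i => s i ^ 2) (fun _ _ => sq_nonneg _)
  simp only [Finset.mem_filter, Finset.mem_univ, true_and, Fin.val_rev]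
  have := j.isLt
  omega

lemma inner_bound {m : ℕ} {x : Idx (m + 1) → ℝ} {L : Matrix (Fin (m + 1)) (Fin (m + 1)) ℝ}
    (h : IsChol x L) (α θ κ : ℝ) (hα0 : 0 ≤ α)
    (hθ : 0 < θ) (hαθ : α + θ ≤ 1) (hκ : 2 * κ * (m + 1) = θ) :
    ENNReal.ofReal (|L 0 0| ^ θ) * ∫⁻ z : Fin m → ℝ,
      ENNReal.ofReal ((∏ k, TT m (sol L z) k ^ (-(1:ℝ) / 2 + κ / 2)) *
        TT m (sol L z) 0 ^ (α / 2)) ≤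
      ENNReal.ofReal (m + 1) * ((m + 1 : ℕ) * KK m κ) := by
  rw [← lintegral_const_mul' _ _ ENNReal.ofReal_ne_top]
  have hmeas : ∀ i : Fin (m + 1), Measurable (fun z : Fin m → ℝ =>
      ENNReal.ofReal (∏ j : Fin m, phi κ (Matrix.toLin'
        ((L⁻¹).submatrix Fin.succ i.succAbove).transpose z j))) := by
    intro i
    apply Measurable.ennreal_ofReal
    apply Continuous.measurable
    apply continuous_finsetProd
    intro j _
    exact (phi_cont κ).comp ((continuous_apply j).comp
      (LinearMap.continuous_of_finiteDimensional (Matrix.toLin'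
        ((L⁻¹).submatrix Fin.succ i.succAbove).transpose)))
  calc _ ≤ ∫⁻ z : Fin m → ℝ, ENNReal.ofReal (m + 1) * ∑ i : Fin (m + 1),
        ENNReal.ofReal |L i 0| * ENNReal.ofReal (∏ j : Fin m, phi κ (Matrix.toLin'
        ((L⁻¹).submatrix Fin.succ i.succAbove).transpose z j)) := by
        apply lintegral_mono
        intro z
        simp only
        rw [← ENNReal.ofReal_mul (by positivity)]
        have hp := pointwise (fun j => TT m (sol L z) j.rev) (sol L z) (fun i => L i 0) α θ κ hα0
          hθ hαθ hκ (TT_ge m _) (fun j => TT_mono m _ (by simp [Fin.rev_zero, Fin.le_last]))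
          (fun j => TT_mono m _ (by simp [Fin.rev_last])) h.col
        have e : ∏ j : Fin (m + 1), TT m (sol L z) j.rev ^ (-(1:ℝ) / 2 + κ / 2) =
            ∏ k, TT m (sol L z) k ^ (-(1:ℝ) / 2 + κ / 2) :=
          Equiv.prod_comp Fin.revPerm (fun k => TT m (sol L z) k ^ (-(1:ℝ) / 2 + κ / 2))
        rw [e, Fin.rev_last] at hp
        refine (ENNReal.ofReal_le_ofReal hp).trans ?_
        rw [ENNReal.ofReal_mul (by positivity), ENNReal.ofReal_sum_of_nonneg (fun i _ =>
          mul_nonneg (abs_nonneg _) (Finset.prod_nonneg (fun _ _ => (phi_pos _ _).le)))]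
        simp only [ENNReal.ofReal_mul (abs_nonneg _), sol_succAbove]
        exact le_rfl
    _ = ENNReal.ofReal (m + 1) * ∑ i : Fin (m + 1), ENNReal.ofReal |L i 0| *
        ∫⁻ z : Fin m → ℝ, ENNReal.ofReal (∏ j : Fin m, phi κ (Matrix.toLin'
        ((L⁻¹).submatrix Fin.succ i.succAbove).transpose z j)) := by
        rw [lintegral_const_mul' _ _ ENNReal.ofReal_ne_top,
          lintegral_finsetSum _ (fun i _ => (hmeas i).const_mul _)]
        simp only [lintegral_const_mul' _ _ ENNReal.ofReal_ne_top]
    _ ≤ ENNReal.ofReal (m + 1) * ∑ i : Fin (m + 1), KK m κ := by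
        gcongr with i _
        rw [← h.minor i, ← Matrix.det_transpose]
        exact lin_subst _ κ
    _ = _ := by simp

/-- Gram determinants. -/
noncomputable def gk (n : ℕ) (k : Fin n) (x : Idx n → ℝ) : ℝ :=
  trailingGram n ((k : ℕ) + 1) (by have := k.isLt; omega) (commUnipotent n x)

lemma gk_ge_one (m : ℕ) (k : Fin (m + 1)) (x : Idx (m + 1) → ℝ) : 1 ≤ gk (m + 1) k x :=
  tg_ge_one m _ _ x

lemma gk_cont (n : ℕ) (k : Fin n) : Continuous (gk n k) := by
  unfold gk trailingGram
  apply Continuous.matrix_det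
  apply continuous_matrix
  intro i j
  simp only [Matrix.of_apply]
  apply continuous_finsetSum
  intro l _
  have : ∀ a b, Continuous (fun x : Idx n → ℝ => commUnipotent n x a b) := by
    intro a b
    simp only [commUnipotent, Matrix.of_apply]
    split_ifs
    · exact continuous_apply _
    · exact continuous_const
    · exact continuous_const
  exact (this _ _).mul (this _ _)

noncomputable def FF (m : ℕ) (ε α : ℝ) (x : Idx (m + 1) → ℝ) : ℝ :=
  (∏ k : Fin (m + 1), gk (m + 1) k x ^ (-(1:ℝ) / 2 + ε)) * gk (m + 1) 0 x ^ (α / 2)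

lemma FF_nonneg (m : ℕ) (ε α : ℝ) (x : Idx (m + 1) → ℝ) : 0 ≤ FF m ε α x := by
  have h : ∀ k, 0 ≤ gk (m + 1) k x := fun k => zero_le_one.trans (gk_ge_one m k x)
  exact mul_nonneg (Finset.prod_nonneg (fun k _ => Real.rpow_nonneg (h k) _))
    (Real.rpow_nonneg (h 0) _)

lemma FF_meas (m : ℕ) (ε α : ℝ) : Measurable (FF m ε α) := by
  unfold FF
  have : ∀ k, Measurable (gk (m + 1) k) := fun k => (gk_cont _ k).measurable
  apply Measurable.mul
  · exact Finset.measurable_prod _ (fun k _ => (this k).pow_const _)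
  · exact (this 0).pow_const _

lemma FF_step {m : ℕ} {x : Idx (m + 1) → ℝ} {L : Matrix (Fin (m + 1)) (Fin (m + 1)) ℝ}
    (h : IsChol x L) (ε α : ℝ) (z : Fin m → ℝ) :
    FF (m + 1) ε α (asm m (z, x)) = FF m ε α x *
      ((∏ k, TT m (sol L z) k ^ (-(1:ℝ) / 2 + ε)) * TT m (sol L z) 0 ^ (α / 2)) := by
  have h1 : ∀ k : Fin (m + 1), gk (m + 2) k.castSucc (asm m (z, x)) =
      gk (m + 1) k x * TT m (sol L z) k := fun k =>
    h.step z _ (h.sol_mul z) _ _ _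
  have h2 : gk (m + 2) (Fin.last (m + 1)) (asm m (z, x)) = 1 := tg_full _ _
  have h0 := h1 0
  rw [Fin.castSucc_zero] at h0
  have hg : ∀ k, 0 ≤ gk (m + 1) k x := fun k => zero_le_one.trans (gk_ge_one m k x)
  unfold FF
  rw [Fin.prod_univ_castSucc, h2, Real.one_rpow, mul_one, h0]
  simp only [h1]
  rw [Real.mul_rpow (hg 0) (TT_pos _ _ _).le]
  simp only [Real.mul_rpow (hg _) (TT_pos _ _ _).le, Finset.prod_mul_distrib]
  ring

lemma corner_bound {m : ℕ} {x : Idx (m + 1) → ℝ} {L : Matrix (Fin (m + 1)) (Fin (m + 1)) ℝ}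
    (h : IsChol x L) (θ : ℝ) (hθ : 0 < θ) :
    1 ≤ |L 0 0| ^ θ * ∏ k : Fin (m + 1), gk (m + 1) k x ^ (θ / 2) := by
  have hc := h.corner
  set g := trailingGram (m + 1) m (by omega) (commUnipotent (m + 1) x) with hg
  have hg1 : 1 ≤ g := tg_ge_one _ _ _ _
  have hle : g ^ (θ / 2) ≤ ∏ k : Fin (m + 1), gk (m + 1) k x ^ (θ / 2) := by
    have h1 : ∀ k : Fin (m + 1), 1 ≤ gk (m + 1) k x ^ (θ / 2) := fun k =>
      Real.one_le_rpow (gk_ge_one m k x) (by positivity)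
    obtain _ | m := m
    · have : g = 1 := by simp [hg, trailingGram]
      rw [this, Real.one_rpow]
      simpa using h1 0
    · have e : g = gk (m + 2) ⟨m, by omega⟩ x := rfl
      rw [e]
      calc gk (m + 2) ⟨m, by omega⟩ x ^ (θ / 2) =
          ∏ k : Fin (m + 2), if k = ⟨m, by omega⟩ then gk (m + 2) k x ^ (θ / 2) else 1 := by
            rw [Finset.prod_ite_eq']; simp
        _ ≤ _ := by
            apply Finset.prod_le_prod
            · intro k _
              split_ifs
              · exact zero_le_one.trans (h1 k)
              · exact zero_le_one
            · intro k _
              split_ifs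
              · exact le_rfl
              · exact h1 k
  have e2 : |L 0 0| ^ θ * g ^ (θ / 2) = 1 := by
    have : |L 0 0| ^ θ = (L 0 0 ^ 2) ^ (θ / 2) := by
      rw [← sq_abs, ← Real.rpow_natCast, ← Real.rpow_mul (abs_nonneg _)]
      congr 1; push_cast; ring
    rw [this, ← Real.mul_rpow (sq_nonneg _) (by linarith), hc, Real.one_rpow]
  calc (1:ℝ) = |L 0 0| ^ θ * g ^ (θ / 2) := e2.symm
    _ ≤ _ := mul_le_mul_of_nonneg_left hle (by positivity)

lemma FF_le {m : ℕ} {x : Idx (m + 1) → ℝ} {L : Matrix (Fin (m + 1)) (Fin (m + 1)) ℝ}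
    (h : IsChol x L) (θ ε ε' α : ℝ) (hθ : 0 < θ) (hε : ε + θ / 2 ≤ ε') :
    FF m ε α x ≤ FF m ε' α x * |L 0 0| ^ θ := by
  have h1 := corner_bound h θ hθ
  have hg : ∀ k, 0 < gk (m + 1) k x := fun k => zero_lt_one.trans_le (gk_ge_one m k x)
  calc FF m ε α x ≤ FF m ε α x * (|L 0 0| ^ θ * ∏ k : Fin (m + 1), gk (m + 1) k x ^ (θ / 2)) :=
        le_mul_of_one_le_right (FF_nonneg _ _ _ _) h1
    _ = FF m (ε + θ / 2) α x * |L 0 0| ^ θ := by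
        unfold FF
        have : ∀ k, gk (m + 1) k x ^ (-(1:ℝ) / 2 + (ε + θ / 2)) =
          gk (m + 1) k x ^ (-(1:ℝ) / 2 + ε) * gk (m + 1) k x ^ (θ / 2) := fun k => by
            rw [← Real.rpow_add (hg k)]; ring_nf
        simp only [this, Finset.prod_mul_distrib]
        ring
    _ ≤ _ := by
        apply mul_le_mul_of_nonneg_right _ (by positivity)
        unfold FF
        apply mul_le_mul_of_nonneg_right _ (Real.rpow_nonneg (hg 0).le _)
        apply Finset.prod_le_prod
        · intro k _; exact Real.rpow_nonneg (hg k).le _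
        · intro k _
          exact Real.rpow_le_rpow_of_exponent_le (gk_ge_one m k x) (by linarith)

theorem main_ind (α : ℝ) (hα0 : 0 ≤ α) (hα1 : α < 1) : ∀ m : ℕ, ∃ ε : ℝ, 0 < ε ∧
    ∫⁻ x : Idx (m + 1) → ℝ, ENNReal.ofReal (FF m ε α x) < ⊤ := by
  intro m
  induction m with
  | zero =>
    refine ⟨1, one_pos, ?_⟩
    have : IsEmpty (Idx (0 + 1)) := ⟨fun p => by
      have h1 := p.1.1.isLt; have h2 := p.1.2.isLt; have h3 := p.2; omega⟩
    have : (volume : Measure (Idx (0 + 1) → ℝ)) = Measure.dirac (fun a => isEmptyElim a) := by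
      rw [volume_pi, Measure.pi_of_empty]
    rw [this, lintegral_dirac]
    exact ENNReal.ofReal_lt_top
  | succ m ih =>
    obtain ⟨ε', hε', hfin⟩ := ih
    set θ : ℝ := min (1 - α) ε' with hθdef
    have hθ : 0 < θ := lt_min (by linarith) hε'
    have hθ1 : θ ≤ 1 - α := min_le_left _ _
    have hθ2 : θ ≤ ε' := min_le_right _ _
    set κ : ℝ := θ / (2 * (m + 1)) with hκdef
    have hm : (0:ℝ) < m + 1 := by positivity
    have hκ : 2 * κ * (m + 1) = θ := by rw [hκdef]; field_simp
    have hκ0 : 0 < κ := by positivity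
    have hκθ : κ ≤ θ := by
      rw [hκdef]; apply div_le_self hθ.le
      have : (0:ℝ) ≤ m := by positivity
      linarith
    refine ⟨κ / 2, by positivity, ?_⟩
    set C : ENNReal := ENNReal.ofReal (m + 1) * ((m + 1 : ℕ) * KK m κ) with hC
    have hCt : C ≠ ⊤ := ENNReal.mul_ne_top ENNReal.ofReal_ne_top
      (ENNReal.mul_ne_top (ENNReal.natCast_ne_top _) (KK_lt_top m κ hκ0).ne)
    have hM : Measurable (fun p : (Fin m → ℝ) × (Idx (m + 1) → ℝ) =>
        ENNReal.ofReal (FF (m + 1) (κ / 2) α (asm m p))) :=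
      ((FF_meas _ _ _).comp (asm m).measurable).ennreal_ofReal
    rw [← (asm_mp m).lintegral_comp (FF_meas (m + 1) (κ / 2) α).ennreal_ofReal,
      Measure.volume_eq_prod, lintegral_prod_symm' _ hM]
    calc _ ≤ ∫⁻ x : Idx (m + 1) → ℝ, ENNReal.ofReal (FF m ε' α x) * C := by
          apply lintegral_mono
          intro x
          obtain ⟨L, hL⟩ := exists_chol x
          simp only [FF_step hL, ENNReal.ofReal_mul (FF_nonneg _ _ _ _)]
          rw [lintegral_const_mul' _ _ ENNReal.ofReal_ne_top]
          have hb := inner_bound hL α θ κ hα0 hθ (by linarith) hκ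
          calc _ ≤ ENNReal.ofReal (FF m ε' α x * |L 0 0| ^ θ) * _ :=
                mul_le_mul_left (ENNReal.ofReal_le_ofReal
                  (FF_le hL θ (κ / 2) ε' α hθ (by linarith))) _
            _ ≤ _ := by
                rw [ENNReal.ofReal_mul (FF_nonneg _ _ _ _), mul_assoc]
                exact mul_le_mul_right hb _
      _ = (∫⁻ x : Idx (m + 1) → ℝ, ENNReal.ofReal (FF m ε' α x)) * C := by
          rw [lintegral_mul_const' _ _ hCt]
      _ < ⊤ := ENNReal.mul_lt_top hfin hCt.lt_top

lemma log_bound (r ε : ℝ) (hε : 0 < ε) : ∃ C : ℝ, 0 ≤ C ∧ ∀ P : ℝ, 1 ≤ P →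
    (1 + 1 / 2 * Real.log P) ^ r ≤ C * P ^ ε := by
  set η := ε / (|r| + 1) with hη
  have hr := abs_nonneg r
  have hη0 : 0 < η := by positivity
  refine ⟨(1 + 1 / η) ^ |r|, by positivity, fun P hP => ?_⟩
  have hl := Real.log_nonneg hP
  have h1 : 1 + 1 / 2 * Real.log P ≤ (1 + 1 / η) * P ^ η := by
    have h2 := Real.log_le_rpow_div (by linarith : 0 ≤ P) hη0
    have h3 : 1 ≤ P ^ η := Real.one_le_rpow hP hη0.le
    have h4 : (1 + 1 / η) * P ^ η = P ^ η + P ^ η / η := by ring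
    rw [h4]; linarith
  calc (1 + 1 / 2 * Real.log P) ^ r ≤ (1 + 1 / 2 * Real.log P) ^ |r| :=
        Real.rpow_le_rpow_of_exponent_le (by linarith) (le_abs_self r)
    _ ≤ ((1 + 1 / η) * P ^ η) ^ |r| := Real.rpow_le_rpow (by linarith) h1 hr
    _ = (1 + 1 / η) ^ |r| * P ^ (η * |r|) := by
        rw [Real.mul_rpow (by positivity) (by positivity), ← Real.rpow_mul (by linarith)]
    _ ≤ _ := by
        apply mul_le_mul_of_nonneg_left _ (by positivity)
        apply Real.rpow_le_rpow_of_exponent_le hP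
        rw [hη, div_mul_eq_mul_div, div_le_iff₀ (by positivity)]
        nlinarith

end Tame

theorem stmt_12 (n : ℕ) (hn : 3 ≤ n) (α : ℝ) (hα0 : 0 ≤ α) (hα1 : α < 1) (r : ℝ) :
    Integrable (fun x : {p : Fin n × Fin n // (p.1 : ℕ) + 1 < (p.2 : ℕ)} → ℝ =>
      (∏ k : Fin (n - 1),
          trailingGram n ((k : ℕ) + 1) (by have := k.isLt; omega) (commUnipotent n x))
          ^ (-(1 : ℝ) / 2) *
        (trailingGram n 1 (by omega) (commUnipotent n x)) ^ (α / 2) *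
        (1 + (1 / 2) * ∑ k : Fin (n - 1),
          Real.log (trailingGram n ((k : ℕ) + 1) (by have := k.isLt; omega)
            (commUnipotent n x))) ^ r) volume := by
  obtain ⟨m, rfl⟩ : ∃ m, n = m + 1 := ⟨n - 1, by omega⟩
  obtain ⟨ε, hε, hfin⟩ := Tame.main_ind α hα0 hα1 m
  obtain ⟨C, hC, hlog⟩ := Tame.log_bound r ε hε
  have hint : Integrable (Tame.FF m ε α) volume :=
    ⟨(Tame.FF_meas m ε α).aestronglyMeasurable, by
      rw [hasFiniteIntegral_iff_ofReal (Filter.Eventually.of_forall (Tame.FF_nonneg m ε α))]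
      exact hfin⟩
  have hm : ∀ (k : ℕ) (hk : k + 1 ≤ m + 1), Measurable (fun x : Tame.Idx (m + 1) → ℝ =>
      trailingGram (m + 1) (k + 1) hk (commUnipotent (m + 1) x)) := fun k hk =>
    (Tame.gk_cont (m + 1) ⟨k, by omega⟩).measurable
  refine (hint.const_mul C).mono' ?_ (Filter.Eventually.of_forall fun x => ?_)
  · apply Measurable.aestronglyMeasurable
    refine ((Measurable.pow_const ?_ _).mul ((hm 0 (by omega)).pow_const _)).mul
      (Measurable.pow_const ?_ _)
    · exact Finset.measurable_prod _ (fun k _ => hm k _)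
    · refine Measurable.const_add (Measurable.const_mul ?_ _) _
      refine Finset.measurable_sum _ (fun k _ => ?_)
      exact (hm (k : ℕ) (by have := k.isLt; omega)).log
  · have hg1 : ∀ k : Fin (m + 1), 1 ≤ Tame.gk (m + 1) k x := fun k => Tame.gk_ge_one m k x
    have hg0 : ∀ k : Fin (m + 1), 0 < Tame.gk (m + 1) k x := fun k =>
      zero_lt_one.trans_le (hg1 k)
    have hlast : Tame.gk (m + 1) (Fin.last m) x = 1 := Tame.tg_full _ _
    have e1 : (∏ k : Fin (m + 1 - 1), trailingGram (m + 1) ((k : ℕ) + 1)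
        (by have := k.isLt; omega) (commUnipotent (m + 1) x)) =
        ∏ k : Fin (m + 1), Tame.gk (m + 1) k x := by
      rw [Fin.prod_univ_castSucc, hlast, mul_one]; rfl
    have e2 : (∑ k : Fin (m + 1 - 1), Real.log (trailingGram (m + 1) ((k : ℕ) + 1)
        (by have := k.isLt; omega) (commUnipotent (m + 1) x))) =
        Real.log (∏ k : Fin (m + 1), Tame.gk (m + 1) k x) := by
      rw [Real.log_prod (fun k _ => (hg0 k).ne'), Fin.sum_univ_castSucc, hlast, Real.log_one,
        add_zero]; rfl
    have e3 : trailingGram (m + 1) 1 (by omega) (commUnipotent (m + 1) x) =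
        Tame.gk (m + 1) 0 x := rfl
    rw [e1, e2, e3]
    set P := ∏ k : Fin (m + 1), Tame.gk (m + 1) k x with hP
    have hP1 : 1 ≤ P := by
      calc (1:ℝ) = ∏ _k : Fin (m + 1), (1:ℝ) := by simp
        _ ≤ P := Finset.prod_le_prod (fun _ _ => zero_le_one) (fun k _ => hg1 k)
    have hP0 : 0 < P := zero_lt_one.trans_le hP1
    have hl := Real.log_nonneg hP1
    have hFF : Tame.FF m ε α x = P ^ (-(1:ℝ) / 2) * P ^ ε * Tame.gk (m + 1) 0 x ^ (α / 2) := by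
      unfold Tame.FF
      rw [← Real.rpow_add hP0, hP, Real.finsetProd_rpow _ _ (fun k _ => (hg0 k).le)]
    have hA : 0 ≤ P ^ (-(1:ℝ) / 2) * Tame.gk (m + 1) 0 x ^ (α / 2) :=
      mul_nonneg (Real.rpow_nonneg hP0.le _) (Real.rpow_nonneg (hg0 0).le _)
    rw [Real.norm_of_nonneg (mul_nonneg hA (Real.rpow_nonneg (by linarith) _)), hFF]
    calc _ ≤ P ^ (-(1:ℝ) / 2) * Tame.gk (m + 1) 0 x ^ (α / 2) * (C * P ^ ε) :=
          mul_le_mul_of_nonneg_left (hlog P hP1) hA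
      _ = _ := by ring
end
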